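/- arXiv:1109.6473 — 4 statements merged into one kernel-verified Lean document; each statement's English description precedes it below -/
import Mathlib

section
/- Let k ≥ 1 be an integer. If m ≥ (k+2)n − 2, then the coefficients of the Poincaré return map expansions of the normal form system (1.22) and of its polynomial truncation (1.24) agree up to order kn: v_j(δ) = v̄_j(δ) for all 1 ≤ j ≤ kn and all δ ∈ D. -/
open Set Filter Metric

/-- `P` is the Poincaré return map (near the origin, with respect to the section
`y = F(x)`) of the planar system `x' = f₁(x,y)`, `y' = f₂(x,y)`. -/
def IsReturnMap (f₁ f₂ : ℝ → ℝ → ℝ) (F : ℝ → ℝ) (P : ℝ → ℝ) : Prop :=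
  P 0 = 0 ∧ ∃ ε > 0, ∀ x₀ : ℝ, x₀ ≠ 0 → |x₀| < ε →
    ∃ γ : ℝ → ℝ × ℝ, γ 0 = (x₀, F x₀) ∧
      (∀ t : ℝ,
        HasDerivAt (fun s => (γ s).1) (f₁ (γ t).1 (γ t).2) t ∧
        HasDerivAt (fun s => (γ s).2) (f₂ (γ t).1 (γ t).2) t) ∧
      ∃ τ : ℝ, 0 < τ ∧ ((γ τ).2 = F (γ τ).1 ∧ 0 < x₀ * (γ τ).1) ∧
        (∀ t : ℝ, 0 < t → t < τ → ¬((γ t).2 = F (γ t).1 ∧ 0 < x₀ * (γ t).1)) ∧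
        P x₀ = (γ τ).1

open scoped Topology NNReal

theorem IsPicardLindelof.exists_hasDerivWithinAt_mem_closedBall
    {E : Type*} [NormedAddCommGroup E] [NormedSpace ℝ E] [CompleteSpace E]
    {f : ℝ → E → E} {tmin tmax : ℝ} {t₀ : Icc tmin tmax} {x₀ : E} {a L K : ℝ≥0}
    (hf : IsPicardLindelof f t₀ x₀ a 0 L K) :
    ∃ α : ℝ → E, α t₀ = x₀ ∧ ∀ t ∈ Icc tmin tmax,
      α t ∈ closedBall x₀ a ∧ HasDerivWithinAt α (f t (α t)) (Icc tmin tmax) t := by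
  have hx : x₀ ∈ closedBall x₀ ((0 : ℝ≥0) : ℝ) := by simp
  obtain ⟨α, hα⟩ := ODE.FunSpace.exists_isFixedPt_next hf hx
  refine ⟨α.compProj,
    by rw [ODE.FunSpace.compProj_val, ← hα, ODE.FunSpace.next_apply₀], fun t ht ↦
      ⟨α.compProj_mem_closedBall hf.mul_max_le, ?_⟩⟩
  apply ODE.hasDerivWithinAt_picard_Icc t₀.2 hf.continuousOn_uncurry
    α.continuous_compProj.continuousOn (fun _ ht' ↦ α.compProj_mem_closedBall hf.mul_max_le)
    x₀ ht |>.congr_of_mem _ ht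
  intro t' ht'
  nth_rw 1 [← hα]
  rw [ODE.FunSpace.compProj_of_mem ht', ODE.FunSpace.next_apply]

/-- An analytic function bounded by `C * x ^ N` on the right of `0` vanishes to order `N`. -/
theorem AnalyticAt.le_analyticOrderAt_of_abs_le {f : ℝ → ℝ} (hf : AnalyticAt ℝ f 0) {N : ℕ} {C : ℝ}
    (h : ∀ᶠ x in 𝓝[>] (0 : ℝ), |f x| ≤ C * x ^ N) : N ≤ analyticOrderAt f 0 := by
  by_contra hlt
  rw [not_le] at hlt
  obtain ⟨d, hd⟩ := ENat.ne_top_iff_exists.1 hlt.ne_top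
  obtain ⟨g, hg, hg0, hfg⟩ := (hf.analyticOrderAt_eq_natCast (n := d)).1 hd.symm
  have hdN : d < N := by rw [← hd] at hlt; exact_mod_cast hlt
  have hle : ∀ᶠ x in 𝓝[>] (0 : ℝ), |g x| ≤ C * x ^ (N - d) := by
    filter_upwards [h, hfg.filter_mono nhdsWithin_le_nhds, self_mem_nhdsWithin] with x h1 h2 h3
    have hx : 0 < x := h3
    rw [h2, sub_zero, smul_eq_mul, abs_mul, abs_of_pos (pow_pos hx d)] at h1
    have : x ^ N = x ^ d * x ^ (N - d) := by rw [← pow_add]; congr 1; omega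
    rw [this] at h1
    refine le_of_mul_le_mul_left ?_ (pow_pos hx d)
    linarith
  have h1 : Tendsto (fun x => |g x|) (𝓝[>] (0 : ℝ)) (𝓝 |g 0|) :=
    (hg.continuousAt.abs.tendsto).mono_left nhdsWithin_le_nhds
  have h2 : Tendsto (fun x : ℝ => C * x ^ (N - d)) (𝓝[>] (0 : ℝ)) (𝓝 0) := by
    have : Tendsto (fun x : ℝ => C * x ^ (N - d)) (𝓝 0) (𝓝 (C * 0 ^ (N - d))) :=
      Continuous.tendsto (by fun_prop) 0
    rw [zero_pow (by omega), mul_zero] at this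
    exact this.mono_left nhdsWithin_le_nhds
  have := le_of_tendsto_of_tendsto h1 h2 hle
  exact hg0 (abs_eq_zero.1 (le_antisymm this (abs_nonneg _)))

theorem AnalyticAt.iteratedDeriv_eq_zero_of_abs_le {f : ℝ → ℝ} (hf : AnalyticAt ℝ f 0)
    {N : ℕ} {C : ℝ} (h : ∀ᶠ x in 𝓝[>] (0 : ℝ), |f x| ≤ C * x ^ (N + 1)) {j : ℕ} (hj : j ≤ N) :
    iteratedDeriv j f 0 = 0 :=
  (natCast_le_analyticOrderAt_iff_iteratedDeriv_eq_zero hf).1 (hf.le_analyticOrderAt_of_abs_le h)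
    j (by omega)

theorem eqOn_Ioo_of_hasDerivAt_smul {E : Type*} [NormedAddCommGroup E] [NormedSpace ℝ E]
    {f : E → E} {T : ℝ → ℝ} {z w : ℝ → E} {a b t₀ : ℝ} (ht₀ : t₀ ∈ Ioo a b)
    (hz : ∀ t ∈ Ioo a b, HasDerivAt z (T t • f (z t)) t)
    (hw : ∀ t ∈ Ioo a b, HasDerivAt w (T t • f (w t)) t)
    (hT : ContinuousOn T (Ioo a b)) (hf : ∀ t ∈ Ioo a b, ContDiffAt ℝ 1 f (z t))
    (h₀ : z t₀ = w t₀) : EqOn z w (Ioo a b) := by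
  have hloc : ∀ t ∈ Ioo a b, z t = w t → z =ᶠ[𝓝 t] w := by
    intro t ht htw
    obtain ⟨K, s, hs, hK⟩ := (hf t ht).exists_lipschitzOnWith
    have hTt : ContinuousAt T t := hT.continuousAt (isOpen_Ioo.mem_nhds ht)
    have hTb : ∀ᶠ r in 𝓝 t, ‖T r‖₊ ≤ ‖T t‖₊ + 1 := by
      have := hTt.nnnorm.eventually (gt_mem_nhds (lt_add_one ‖T t‖₊))
      exact this.mono fun r hr => hr.le
    refine ODE_solution_unique_of_eventually (v := fun r y => T r • f y) (s := fun _ => s)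
      (K := (‖T t‖₊ + 1) * K) ?_ ?_ ?_ htw
    · filter_upwards [hTb] with r hr
      refine LipschitzOnWith.of_dist_le_mul fun x hx y hy => ?_
      have h1 := hK.dist_le_mul x hx y hy
      rw [dist_smul₀, NNReal.coe_mul, mul_assoc]
      exact mul_le_mul (by exact_mod_cast hr) h1 dist_nonneg (by positivity)
    · filter_upwards [isOpen_Ioo.mem_nhds ht, (hz t ht).continuousAt.eventually hs] with r h1 h2
      exact ⟨hz r h1, h2⟩
    · filter_upwards [isOpen_Ioo.mem_nhds ht,
        (hw t ht).continuousAt.eventually (htw ▸ hs)] with r h1 h2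
      exact ⟨hw r h1, h2⟩
  have hzc : ContinuousOn z (Ioo a b) := fun t ht => (hz t ht).continuousAt.continuousWithinAt
  have hwc : ContinuousOn w (Ioo a b) := fun t ht => (hw t ht).continuousAt.continuousWithinAt
  have key : Ioo a b ⊆ {t | z =ᶠ[𝓝 t] w} := by
    refine isPreconnected_Ioo.subset_of_closure_inter_subset
      (by rw [isOpen_iff_eventually]; exact fun t ht => eventually_eventually_nhds.2 ht)
      ⟨t₀, ht₀, hloc t₀ ht₀ h₀⟩ ?_
    rintro t ⟨htc, ht⟩
    refine hloc t ht ?_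
    have hne : (𝓝[{t | z =ᶠ[𝓝 t] w}] t).NeBot := mem_closure_iff_nhdsWithin_neBot.1 htc
    have h1 : Tendsto z (𝓝[{t | z =ᶠ[𝓝 t] w}] t) (𝓝 (z t)) :=
      (hz t ht).continuousAt.tendsto.mono_left nhdsWithin_le_nhds
    have h2 : Tendsto w (𝓝[{t | z =ᶠ[𝓝 t] w}] t) (𝓝 (w t)) :=
      (hw t ht).continuousAt.tendsto.mono_left nhdsWithin_le_nhds
    refine tendsto_nhds_unique_of_eventuallyEq h1 h2 ?_
    filter_upwards [self_mem_nhdsWithin] with r hr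
    exact hr.self_of_nhds
  exact fun t ht => (key ht).self_of_nhds

theorem Real.cos_pos_of_abs_le_one {φ : ℝ} (h : |φ| ≤ 1) : 0 < Real.cos φ := by
  have := Real.pi_gt_three
  rw [abs_le] at h
  exact Real.cos_pos_of_mem_Ioo ⟨by linarith, by linarith⟩

theorem sub_le_sin_div_cos_pow_sub (n : ℕ) (hn : 1 ≤ n) {φ ψ : ℝ} (hφ : -1 ≤ φ) (h : φ ≤ ψ)
    (hψ : ψ ≤ 1) :
    ψ - φ ≤ Real.sin ψ / Real.cos ψ ^ n - Real.sin φ / Real.cos φ ^ n := by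
  have hc : ∀ t ∈ Icc (-1 : ℝ) 1, 0 < Real.cos t := fun t ht =>
    Real.cos_pos_of_abs_le_one (abs_le.2 ht)
  have hd : ∀ t ∈ Icc (-1 : ℝ) 1, HasDerivAt (fun t => Real.sin t / Real.cos t ^ n)
      ((Real.cos t * Real.cos t ^ n - Real.sin t * (n * Real.cos t ^ (n - 1) * (-Real.sin t))) /
        (Real.cos t ^ n) ^ 2) t := fun t ht =>
    (Real.hasDerivAt_sin t).div ((Real.hasDerivAt_cos t).pow n) (pow_pos (hc t ht) n).ne'
  have := (convex_Icc (-1 : ℝ) 1).mul_sub_le_image_sub_of_le_deriv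
    (f := fun t => Real.sin t / Real.cos t ^ n) (C := 1)
    (fun t ht => (hd t ht).continuousAt.continuousWithinAt)
    (fun t ht => (hd t (interior_subset ht)).differentiableAt.differentiableWithinAt) ?_
    φ ⟨hφ, h.trans hψ⟩ ψ ⟨hφ.trans h, hψ⟩ h
  · simpa using this
  intro t ht
  have ht := interior_subset ht
  rw [(hd t ht).deriv]
  have h1 := hc t ht
  have h2 := Real.cos_le_one t
  obtain ⟨k, rfl⟩ := Nat.exists_eq_add_of_le' hn
  rw [le_div_iff₀ (by positivity), one_mul, Nat.add_sub_cancel]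
  have h3 : Real.cos t ^ k ≤ 1 := pow_le_one₀ h1.le h2
  have h4 : 0 < Real.cos t ^ k := pow_pos h1 k
  have h5 := Real.sin_sq_add_cos_sq t
  have h6 : (Real.cos t ^ (k + 1)) ^ 2 ≤ Real.cos t ^ k := by
    have : (Real.cos t ^ (k + 1)) ^ 2 = Real.cos t ^ k * (Real.cos t ^ k * Real.cos t ^ 2) := by
      ring
    rw [this]
    have : Real.cos t ^ k * Real.cos t ^ 2 ≤ 1 := by
      have : Real.cos t ^ 2 ≤ 1 := pow_le_one₀ h1.le h2
      nlinarith
    nlinarith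
  have h7 : Real.cos t * Real.cos t ^ (k + 1) -
      Real.sin t * (((k + 1 : ℕ) : ℝ) * Real.cos t ^ k * -Real.sin t) =
      Real.cos t ^ k * (Real.cos t ^ 2 + (k + 1) * Real.sin t ^ 2) := by
    push_cast; ring
  rw [h7]
  have h8 : 1 ≤ Real.cos t ^ 2 + (k + 1) * Real.sin t ^ 2 := by
    have : 0 ≤ (k : ℝ) * Real.sin t ^ 2 := by positivity
    nlinarith
  nlinarith

/-- The logarithmic radial derivative `d(log r)/dφ` of the trajectories of `x' = f₁`, `y' = f₂` in
the quasi-homogeneous polar coordinates `x = r cos φ`, `y = -rⁿ sin φ`. -/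
noncomputable def polarSlope (n : ℕ) (f₁ f₂ : ℝ → ℝ → ℝ) (φ r : ℝ) : ℝ :=
  (Real.sin φ * f₂ (r * Real.cos φ) (-(r ^ n * Real.sin φ)) -
      Real.cos φ * r ^ (n - 1) * f₁ (r * Real.cos φ) (-(r ^ n * Real.sin φ))) /
    (Real.cos φ * f₂ (r * Real.cos φ) (-(r ^ n * Real.sin φ)) +
      n * Real.sin φ * r ^ (n - 1) * f₁ (r * Real.cos φ) (-(r ^ n * Real.sin φ)))

/-- The denominator of `polarSlope`; its sign is that of the angular velocity `-φ'`. -/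
noncomputable def polarDenom (n : ℕ) (f₁ f₂ : ℝ → ℝ → ℝ) (φ r : ℝ) : ℝ :=
  Real.cos φ * f₂ (r * Real.cos φ) (-(r ^ n * Real.sin φ)) +
      n * Real.sin φ * r ^ (n - 1) * f₁ (r * Real.cos φ) (-(r ^ n * Real.sin φ))

/-- The value of `polarSlope` for the system `x' = y`, `y' = -r^(2n-1) G(φ, r)`. -/
noncomputable def modelSlope (n : ℕ) (G : ℝ → ℝ → ℝ) (φ r : ℝ) : ℝ :=
  (Real.sin φ * G φ r - Real.cos φ * Real.sin φ) /
    (Real.cos φ * G φ r + n * Real.sin φ ^ 2)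

/-- Uniform bounds on `modelSlope` over one turn. -/
structure ModelBounds (n : ℕ) (G : ℝ → ℝ → ℝ) (κ A L ρ : ℝ) : Prop where
  pos : 0 < κ
  denom_ge : ∀ φ ∈ Icc (-1) (2 * Real.pi + 1), ∀ r ∈ Icc 0 ρ,
    κ ≤ Real.cos φ * G φ r + n * Real.sin φ ^ 2
  num_le : ∀ φ ∈ Icc (-1) (2 * Real.pi + 1), ∀ r ∈ Icc 0 ρ,
    |Real.sin φ * G φ r - Real.cos φ * Real.sin φ| ≤ A
  lipschitz : ∀ φ ∈ Icc (-1) (2 * Real.pi + 1), ∀ r ∈ Icc 0 ρ, ∀ r' ∈ Icc 0 ρ,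
    |modelSlope n G φ r - modelSlope n G φ r'| ≤ L * |r - r'|

/-- The system `x' = f₁`, `y' = f₂` agrees with the model `x' = y`, `y' = -r^(2n-1) G(φ, r)` up to
relative order `p` in the quasi-homogeneous radius, and the section `y = F x = xⁿ W x` agrees with
the `x`-axis to the same relative order. -/
structure IsModelPerturbation (n p : ℕ) (G : ℝ → ℝ → ℝ) (f₁ f₂ : ℝ → ℝ → ℝ) (F W : ℝ → ℝ)
    (C ρ : ℝ) : Prop where
  C_nonneg : 0 ≤ C
  pos : 0 < ρ
  le_one : ρ ≤ 1
  contDiff₁ : ∀ q : ℝ × ℝ, ‖q‖ < ρ → ContDiffAt ℝ 1 (fun q : ℝ × ℝ => f₁ q.1 q.2) q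
  contDiff₂ : ∀ q : ℝ × ℝ, ‖q‖ < ρ → ContDiffAt ℝ 1 (fun q : ℝ × ℝ => f₂ q.1 q.2) q
  error₁ : ∀ φ r : ℝ, 0 < r → r < ρ →
    |f₁ (r * Real.cos φ) (-(r ^ n * Real.sin φ)) + r ^ n * Real.sin φ| ≤ C * r ^ n * r ^ p
  error₂ : ∀ φ r : ℝ, 0 < r → r < ρ →
    |f₂ (r * Real.cos φ) (-(r ^ n * Real.sin φ)) + r ^ (n - 1) * r ^ n * G φ r| ≤
      C * (r ^ (n - 1) * r ^ n) * r ^ p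
  section_eq : ∀ x, 0 < x → x < ρ → F x = x ^ n * W x
  section_le : ∀ x, 0 < x → x < ρ → |W x| ≤ C * x ^ p
  section_lipschitz : ∀ x ∈ Ioo 0 ρ, ∀ y ∈ Ioo 0 ρ, |W x - W y| ≤ C * |x - y|

theorem abs_div_sub_div_le {N D N' D' κ A e : ℝ} (hκ : 0 < κ) (hD : κ ≤ D) (hN : |N| ≤ A)
    (hN' : |N' - N| ≤ e) (hD' : |D' - D| ≤ e) (he : e ≤ κ / 2) :
    κ / 2 ≤ D' ∧ |N' / D' - N / D| ≤ (2 / κ + 2 * A / κ ^ 2) * e := by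
  have h1 : κ / 2 ≤ D' := by
    have := (abs_le.1 hD').1
    linarith
  refine ⟨h1, ?_⟩
  have hDp : 0 < D := hκ.trans_le hD
  have hDp' : 0 < D' := (half_pos hκ).trans_le h1
  have h0 : 0 ≤ e := (abs_nonneg _).trans hN'
  have hA : 0 ≤ A := (abs_nonneg _).trans hN
  have : N' / D' - N / D = (N' - N) / D' - N * (D' - D) / (D' * D) := by
    field_simp; ring
  rw [this]
  refine (abs_sub _ _).trans ?_
  rw [abs_div, abs_div, abs_mul, abs_mul, abs_of_pos hDp, abs_of_pos hDp']
  have h2 : |N' - N| / D' ≤ e / (κ / 2) := by gcongr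
  have h3 : |N| * |D' - D| / (D' * D) ≤ A * e / (κ / 2 * κ) := by gcongr
  have h4 : e / (κ / 2) + A * e / (κ / 2 * κ) = (2 / κ + 2 * A / κ ^ 2) * e := by
    field_simp
  linarith

namespace IsModelPerturbation

variable {n p : ℕ} {G : ℝ → ℝ → ℝ} {f₁ f₂ : ℝ → ℝ → ℝ} {F W : ℝ → ℝ} {κ A L C ρ ρ₀ : ℝ}

theorem polarSlope_estimate (h : IsModelPerturbation n p G f₁ f₂ F W C ρ)
    (hG : ModelBounds n G κ A L ρ₀) {φ r : ℝ}
    (hφ : φ ∈ Icc (-1) (2 * Real.pi + 1)) (hr : 0 < r) (hrρ : r < ρ) (hrρ₀ : r ≤ ρ₀)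
    (hsmall : (n + 2) * C * r ^ p ≤ κ / 2) :
    polarDenom n f₁ f₂ φ r < 0 ∧
    |polarSlope n f₁ f₂ φ r - modelSlope n G φ r| ≤
      (2 / κ + 2 * A / κ ^ 2) * ((n + 2) * C * r ^ p) := by
  have e1 := h.error₁ φ r hr hrρ
  have e2 := h.error₂ φ r hr hrρ
  unfold polarDenom polarSlope modelSlope
  generalize f₁ (r * Real.cos φ) (-(r ^ n * Real.sin φ)) = v₁ at *
  generalize f₂ (r * Real.cos φ) (-(r ^ n * Real.sin φ)) = v₂ at *
  have hd := hG.denom_ge φ hφ r ⟨hr.le, hrρ₀⟩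
  have hN := hG.num_le φ hφ r ⟨hr.le, hrρ₀⟩
  have hs := Real.abs_sin_le_one φ
  have hc := Real.abs_cos_le_one φ
  generalize Real.sin φ = s at *
  generalize Real.cos φ = c at *
  have ha : 0 < r ^ (n - 1) := pow_pos hr _
  have hb : 0 < r ^ n := pow_pos hr _
  have hq : 0 < r ^ p := pow_pos hr _
  have hC := h.C_nonneg
  generalize r ^ (n - 1) = a at *
  generalize r ^ n = b at *
  generalize r ^ p = q at *
  obtain ⟨w₁, rfl⟩ : ∃ w, v₁ = b * w := ⟨v₁ / b, by field_simp⟩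
  obtain ⟨w₂, rfl⟩ : ∃ w, v₂ = a * b * w := ⟨v₂ / (a * b), by field_simp⟩
  have e1' : |w₁ + s| ≤ C * q := by
    rw [← mul_add, abs_mul, abs_of_pos hb] at e1
    refine le_of_mul_le_mul_left ?_ hb
    linarith
  have hab : 0 < a * b := mul_pos ha hb
  have e2' : |w₂ + G φ r| ≤ C * q := by
    rw [← mul_add, abs_mul, abs_of_pos hab] at e2
    refine le_of_mul_le_mul_left ?_ hab
    linarith
  have k1 : |-(s * w₂ - c * w₁) - (s * G φ r - c * s)| ≤ (n + 2) * C * q := by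
    have : -(s * w₂ - c * w₁) - (s * G φ r - c * s) = -(s * (w₂ + G φ r)) + c * (w₁ + s) := by
      ring
    rw [this]
    refine (abs_add_le _ _).trans ?_
    rw [abs_neg, abs_mul, abs_mul]
    have h1 : |s| * |w₂ + G φ r| ≤ 1 * (C * q) := by gcongr
    have h2 : |c| * |w₁ + s| ≤ 1 * (C * q) := by gcongr
    have h3 : 0 ≤ (n : ℝ) * (C * q) := by positivity
    linarith
  have k2 : |-(c * w₂ + n * s * w₁) - (c * G φ r + n * s ^ 2)| ≤ (n + 2) * C * q := by
    have : -(c * w₂ + n * s * w₁) - (c * G φ r + n * s ^ 2) =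
        -(c * (w₂ + G φ r)) - n * (s * (w₁ + s)) := by
      ring
    rw [this]
    refine (abs_sub _ _).trans ?_
    rw [abs_neg, abs_mul, abs_mul, abs_mul, Nat.abs_cast]
    have h1 : |c| * |w₂ + G φ r| ≤ 1 * (C * q) := by gcongr
    have h2 : n * (|s| * |w₁ + s|) ≤ n * (1 * (C * q)) := by gcongr
    have h3 : 0 ≤ C * q := by positivity
    linarith
  obtain ⟨h1, h2⟩ := abs_div_sub_div_le hG.pos hd hN k1 k2 hsmall
  have hκ := hG.pos
  constructor
  · have : c * (a * b * w₂) + n * s * a * (b * w₁) = -(a * b * (-(c * w₂ + n * s * w₁))) := by ring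
    rw [this, neg_lt_zero]
    exact mul_pos hab (by linarith)
  · have : (s * (a * b * w₂) - c * a * (b * w₁)) / (c * (a * b * w₂) + n * s * a * (b * w₁)) =
        -(s * w₂ - c * w₁) / -(c * w₂ + n * s * w₁) := by
      rw [← mul_div_mul_left (-(s * w₂ - c * w₁)) _ (neg_ne_zero.2 hab.ne')]
      congr 1 <;> ring
    rw [this]
    exact h2

theorem norm_polar_lt (h : IsModelPerturbation n p G f₁ f₂ F W C ρ) (hn : 1 ≤ n) (φ : ℝ) {r : ℝ}
    (hr : 0 < r) (hrρ : r < ρ) : ‖(r * Real.cos φ, -(r ^ n * Real.sin φ))‖ < ρ := by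
  refine lt_of_le_of_lt ?_ hrρ
  rw [Prod.norm_mk, Real.norm_eq_abs, Real.norm_eq_abs, abs_neg, abs_mul, abs_mul, abs_pow,
    abs_of_pos hr]
  have h1 : r ^ n ≤ r := pow_le_of_le_one hr.le (hrρ.le.trans h.le_one) (by omega)
  refine max_le (mul_le_of_le_one_right hr.le (Real.abs_cos_le_one φ)) ?_
  exact (mul_le_of_le_one_right (by positivity) (Real.abs_sin_le_one φ)).trans h1

theorem contDiffAt_polarSlope (h : IsModelPerturbation n p G f₁ f₂ F W C ρ) (hn : 1 ≤ n)
    {x₀ φ u : ℝ} (hr : 0 < x₀ * Real.exp u) (hrρ : x₀ * Real.exp u < ρ)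
    (hne : polarDenom n f₁ f₂ φ (x₀ * Real.exp u) ≠ 0) :
    ContDiffAt ℝ 1 (fun q : ℝ × ℝ => polarSlope n f₁ f₂ q.1 (x₀ * Real.exp q.2)) (φ, u) ∧
    ContDiffAt ℝ 1 (fun q : ℝ × ℝ => polarDenom n f₁ f₂ q.1 (x₀ * Real.exp q.2)) (φ, u) := by
  have hmem := h.norm_polar_lt hn φ hr hrρ
  have hg : ContDiffAt ℝ 1 (fun q : ℝ × ℝ => ((x₀ * Real.exp q.2) * Real.cos q.1,
      -((x₀ * Real.exp q.2) ^ n * Real.sin q.1))) (φ, u) := by fun_prop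
  have c1 := ContDiffAt.comp (φ, u) (h.contDiff₁ _ hmem) hg
  have c2 := ContDiffAt.comp (φ, u) (h.contDiff₂ _ hmem) hg
  have hs : ContDiffAt ℝ 1 (fun q : ℝ × ℝ => Real.sin q.1) (φ, u) := by fun_prop
  have hc : ContDiffAt ℝ 1 (fun q : ℝ × ℝ => Real.cos q.1) (φ, u) := by fun_prop
  have hp : ContDiffAt ℝ 1 (fun q : ℝ × ℝ => (x₀ * Real.exp q.2) ^ (n - 1)) (φ, u) := by fun_prop
  have hd := (hc.mul c2).add (((contDiffAt_const (c := (n : ℝ))).mul hs).mul hp |>.mul c1)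
  exact ⟨((hs.mul c2).sub ((hc.mul hp).mul c1)).div hd hne, hd⟩

end IsModelPerturbation

/-- Trajectories in polar form: if `log r` has slope `polarSlope`, then the corresponding planar
curve is tangent to the vector field. -/
theorem hasDerivAt_polar_curve {n : ℕ} (hn : 1 ≤ n) {f₁ f₂ : ℝ → ℝ → ℝ} {u : ℝ → ℝ} {x₀ φ : ℝ}
    (hu : HasDerivAt u (polarSlope n f₁ f₂ φ (x₀ * Real.exp (u φ))) φ)
    (hne : polarDenom n f₁ f₂ φ (x₀ * Real.exp (u φ)) ≠ 0) :
    HasDerivAt (fun φ => (x₀ * Real.exp (u φ) * Real.cos φ,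
        -((x₀ * Real.exp (u φ)) ^ n * Real.sin φ)))
      ((-(x₀ * Real.exp (u φ)) ^ n * (n * Real.sin φ ^ 2 + Real.cos φ ^ 2) /
        polarDenom n f₁ f₂ φ (x₀ * Real.exp (u φ))) •
        (f₁ (x₀ * Real.exp (u φ) * Real.cos φ) (-((x₀ * Real.exp (u φ)) ^ n * Real.sin φ)),
          f₂ (x₀ * Real.exp (u φ) * Real.cos φ) (-((x₀ * Real.exp (u φ)) ^ n * Real.sin φ)))) φ := by
  have hr := hu.exp.const_mul x₀
  have h1 := hr.mul (Real.hasDerivAt_cos φ)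
  have h2 := ((hr.pow n).mul (Real.hasDerivAt_sin φ)).neg
  refine (h1.prodMk h2).congr_deriv ?_
  unfold polarSlope polarDenom at *
  obtain ⟨k, rfl⟩ := Nat.exists_eq_add_of_le' hn
  simp only [Nat.add_sub_cancel] at *
  generalize f₁ (x₀ * Real.exp (u φ) * Real.cos φ)
    (-((x₀ * Real.exp (u φ)) ^ (k + 1) * Real.sin φ)) = v₁ at *
  generalize f₂ (x₀ * Real.exp (u φ) * Real.cos φ)
    (-((x₀ * Real.exp (u φ)) ^ (k + 1) * Real.sin φ)) = v₂ at *
  simp only [Pi.pow_apply, ← mul_assoc]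
  clear hr h1 h2 hu
  generalize hr : x₀ * Real.exp (u φ) = r at *
  generalize hD : Real.cos φ * v₂ + ((k + 1 : ℕ) : ℝ) * Real.sin φ * r ^ k * v₁ = D at *
  rw [Prod.smul_mk, smul_eq_mul, smul_eq_mul]
  congr 1
  · field_simp
    rw [← hD]
    push_cast
    ring
  · field_simp
    rw [← hD]
    push_cast
    rw [← hr]
    ring

namespace IsModelPerturbation

variable {n p : ℕ} {G : ℝ → ℝ → ℝ} {f₁ f₂ : ℝ → ℝ → ℝ} {F W : ℝ → ℝ} {κ A L C ρ ρ₀ : ℝ}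

theorem polarSlope_bounds (h : IsModelPerturbation n p G f₁ f₂ F W C ρ)
    (hG : ModelBounds n G κ A L ρ₀) {φ r R : ℝ}
    (hφ : φ ∈ Icc (-1) (2 * Real.pi + 1)) (hr : 0 < r) (hrR : r ≤ R) (hR : R < ρ) (hR₀ : R ≤ ρ₀)
    (h₁ : (n + 2) * C * R ^ p ≤ κ / 2)
    (h₂ : (2 / κ + 2 * A / κ ^ 2) * ((n + 2) * C * R ^ p) ≤ 1) :
    polarDenom n f₁ f₂ φ r < 0 ∧
    |polarSlope n f₁ f₂ φ r - modelSlope n G φ r| ≤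
      (2 / κ + 2 * A / κ ^ 2) * ((n + 2) * C * R ^ p) ∧
    |polarSlope n f₁ f₂ φ r| ≤ A / κ + 1 := by
  have hC := h.C_nonneg
  have hκ := hG.pos
  have hd := hG.denom_ge φ hφ r ⟨hr.le, hrR.trans hR₀⟩
  have hN := hG.num_le φ hφ r ⟨hr.le, hrR.trans hR₀⟩
  have hA : 0 ≤ A := (abs_nonneg _).trans hN
  have hpow : (n + 2) * C * r ^ p ≤ (n + 2) * C * R ^ p := by gcongr
  obtain ⟨e1, e2⟩ := h.polarSlope_estimate hG hφ hr (hrR.trans_lt hR) (hrR.trans hR₀)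
    (hpow.trans h₁)
  have e3 := e2.trans (mul_le_mul_of_nonneg_left hpow (by positivity))
  refine ⟨e1, e3, ?_⟩
  have hm : |modelSlope n G φ r| ≤ A / κ := by
    unfold modelSlope
    rw [abs_div, abs_of_pos (hκ.trans_le hd)]
    gcongr
  have := abs_sub_abs_le_abs_sub (polarSlope n f₁ f₂ φ r) (modelSlope n G φ r)
  linarith

theorem exists_log_radius (h : IsModelPerturbation n p G f₁ f₂ F W C ρ) (hn : 1 ≤ n)
    (hG : ModelBounds n G κ A L ρ₀) {x₀ U φ₀ u₀ : ℝ} (hx₀ : 0 < x₀) (hA : 0 ≤ A)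
    (hU : U = (A / κ + 1) * (2 * Real.pi + 2) + 1)
    (hR : x₀ * Real.exp U < ρ) (hR₀ : x₀ * Real.exp U ≤ ρ₀)
    (h₁ : (n + 2) * C * (x₀ * Real.exp U) ^ p ≤ κ / 2)
    (h₂ : (2 / κ + 2 * A / κ ^ 2) * ((n + 2) * C * (x₀ * Real.exp U) ^ p) ≤ 1)
    (hφ₀ : φ₀ ∈ Icc (-1) (2 * Real.pi + 1)) (hu₀ : |u₀| ≤ 1) :
    ∃ u : ℝ → ℝ, u φ₀ = u₀ ∧ ∀ φ ∈ Icc (-1) (2 * Real.pi + 1), |u φ| ≤ U ∧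
      HasDerivWithinAt u (polarSlope n f₁ f₂ φ (x₀ * Real.exp (u φ)))
        (Icc (-1) (2 * Real.pi + 1)) φ := by
  have hκ := hG.pos
  have hπ := Real.pi_pos
  have hr : ∀ v ∈ Icc (-U) U, 0 < x₀ * Real.exp v ∧ x₀ * Real.exp v ≤ x₀ * Real.exp U :=
    fun v hv => ⟨by positivity, by gcongr; exact hv.2⟩
  have hball : closedBall u₀ ((A / κ + 1) * (2 * Real.pi + 2)) ⊆ Icc (-U) U := by
    intro v hv
    rw [mem_closedBall, Real.dist_eq, abs_le] at hv
    rw [abs_le] at hu₀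
    constructor <;> linarith [hv.1, hv.2, hu₀.1, hu₀.2]
  have hcd : ContDiffOn ℝ 1 (fun q : ℝ × ℝ => polarSlope n f₁ f₂ q.1 (x₀ * Real.exp q.2))
      (Icc (-1) (2 * Real.pi + 1) ×ˢ Icc (-U) U) := by
    rintro ⟨φ, v⟩ ⟨hφ, hv⟩
    obtain ⟨hr0, hrR⟩ := hr v hv
    have hd := (h.polarSlope_bounds hG hφ hr0 hrR hR hR₀ h₁ h₂).1
    exact (h.contDiffAt_polarSlope hn hr0 (hrR.trans_lt hR) hd.ne).1.contDiffWithinAt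
  obtain ⟨K, hK⟩ := hcd.exists_lipschitzOnWith one_ne_zero
    ((convex_Icc _ _).prod (convex_Icc _ _)) (isCompact_Icc.prod isCompact_Icc)
  have hPL : IsPicardLindelof (fun φ v => polarSlope n f₁ f₂ φ (x₀ * Real.exp v))
      (⟨φ₀, hφ₀⟩ : Icc (-1) (2 * Real.pi + 1)) u₀
      (⟨(A / κ + 1) * (2 * Real.pi + 2), by positivity⟩ : ℝ≥0) 0
      (⟨A / κ + 1, by positivity⟩ : ℝ≥0) K := by
    refine ⟨fun φ hφ => ?_, fun v hv => ?_, fun φ hφ v hv => ?_, ?_⟩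
    · refine LipschitzOnWith.of_dist_le_mul fun v hv w hw => ?_
      have := hK.dist_le_mul (φ, v) ⟨hφ, hball hv⟩ (φ, w) ⟨hφ, hball hw⟩
      rwa [Prod.dist_eq, dist_self, max_eq_right dist_nonneg] at this
    · exact hK.continuousOn.comp (f := fun φ => (φ, v)) (by fun_prop)
        fun φ hφ => ⟨hφ, hball hv⟩
    · obtain ⟨hr0, hrR⟩ := hr v (hball hv)
      exact (h.polarSlope_bounds hG hφ hr0 hrR hR hR₀ h₁ h₂).2.2
    · have : max (2 * Real.pi + 1 - φ₀) (φ₀ - -1) ≤ 2 * Real.pi + 2 :=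
        max_le (by linarith [hφ₀.1]) (by linarith [hφ₀.2])
      change (A / κ + 1) * max (2 * Real.pi + 1 - φ₀) (φ₀ - -1) ≤
        (A / κ + 1) * (2 * Real.pi + 2) - 0
      rw [sub_zero]
      exact mul_le_mul_of_nonneg_left this (by positivity)
  obtain ⟨u, hu, hu'⟩ := hPL.exists_hasDerivWithinAt_mem_closedBall
  exact ⟨u, hu, fun φ hφ => ⟨abs_le.2 (hball (hu' φ hφ).1), (hu' φ hφ).2⟩⟩

/-- A solution of the planar system starting on a polar trajectory follows it after a change of
time. -/
theorem exists_time_change (h : IsModelPerturbation n p G f₁ f₂ F W C ρ) (hn : 1 ≤ n)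
    {x₀ a b φ₀ : ℝ} (hφ₀ : φ₀ ∈ Ioo a b) {u : ℝ → ℝ}
    (hr : ∀ φ ∈ Ioo a b, 0 < x₀ * Real.exp (u φ) ∧ x₀ * Real.exp (u φ) < ρ)
    (hden : ∀ φ ∈ Ioo a b, polarDenom n f₁ f₂ φ (x₀ * Real.exp (u φ)) < 0)
    (hu : ∀ φ ∈ Ioo a b, HasDerivAt u (polarSlope n f₁ f₂ φ (x₀ * Real.exp (u φ))) φ)
    {γ : ℝ → ℝ × ℝ}
    (hγ₀ : γ 0 = (x₀ * Real.exp (u φ₀) * Real.cos φ₀,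
      -((x₀ * Real.exp (u φ₀)) ^ n * Real.sin φ₀)))
    (hγ : ∀ t : ℝ, HasDerivAt (fun s => (γ s).1) (f₁ (γ t).1 (γ t).2) t ∧
        HasDerivAt (fun s => (γ s).2) (f₂ (γ t).1 (γ t).2) t) :
    ∃ t : ℝ → ℝ, t φ₀ = 0 ∧ ContinuousOn t (Ioo a b) ∧ StrictMonoOn t (Ioo a b) ∧
      ∀ φ ∈ Ioo a b, γ (t φ) = (x₀ * Real.exp (u φ) * Real.cos φ,
        -((x₀ * Real.exp (u φ)) ^ n * Real.sin φ)) := by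
  set T : ℝ → ℝ := fun φ => -(x₀ * Real.exp (u φ)) ^ n *
    (n * Real.sin φ ^ 2 + Real.cos φ ^ 2) / polarDenom n f₁ f₂ φ (x₀ * Real.exp (u φ)) with hTdef
  have hTc : ContinuousOn T (Ioo a b) := by
    intro φ hφ
    refine ContinuousAt.continuousWithinAt ?_
    have huc := (hu φ hφ).continuousAt
    have hdc := (h.contDiffAt_polarSlope hn (hr φ hφ).1 (hr φ hφ).2 (hden φ hφ).ne).2.continuousAt
    have hdc' : ContinuousAt (fun φ => polarDenom n f₁ f₂ φ (x₀ * Real.exp (u φ))) φ :=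
      ContinuousAt.comp (f := fun φ => (φ, u φ)) (x := φ) hdc (continuousAt_id.prodMk huc)
    exact ContinuousAt.div (by fun_prop) hdc' (hden φ hφ).ne
  have hTpos : ∀ φ ∈ Ioo a b, 0 < T φ := by
    intro φ hφ
    have h1 : 0 < n * Real.sin φ ^ 2 + Real.cos φ ^ 2 := by
      have hs := Real.sin_sq_add_cos_sq φ
      have hn' : (1 : ℝ) ≤ n := by exact_mod_cast hn
      nlinarith [sq_nonneg (Real.sin φ)]
    have h2 := pow_pos (hr φ hφ).1 n
    rw [hTdef]
    exact div_pos_of_neg_of_neg (by nlinarith) (hden φ hφ)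
  have ht : ∀ φ ∈ Ioo a b, HasDerivAt (fun φ => ∫ ψ in φ₀..φ, T ψ) (T φ) φ := by
    intro φ hφ
    have hsub : uIcc φ₀ φ ⊆ Ioo a b := (ordConnected_Ioo).uIcc_subset hφ₀ hφ
    exact intervalIntegral.integral_hasDerivAt_right
      (hTc.mono hsub).intervalIntegrable
      (hTc.stronglyMeasurableAtFilter isOpen_Ioo φ hφ)
      (hTc.continuousAt (isOpen_Ioo.mem_nhds hφ))
  have htc : ContinuousOn (fun φ => ∫ ψ in φ₀..φ, T ψ) (Ioo a b) :=
    fun φ hφ => (ht φ hφ).continuousAt.continuousWithinAt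
  refine ⟨fun φ => ∫ ψ in φ₀..φ, T ψ, intervalIntegral.integral_same, htc, ?_, ?_⟩
  · refine strictMonoOn_of_deriv_pos (convex_Ioo a b) htc fun φ hφ => ?_
    rw [interior_Ioo] at hφ
    rw [(ht φ hφ).deriv]
    exact hTpos φ hφ
  · have hE := eqOn_Ioo_of_hasDerivAt_smul (f := fun q : ℝ × ℝ => (f₁ q.1 q.2, f₂ q.1 q.2)) (T := T)
      (z := fun φ => (x₀ * Real.exp (u φ) * Real.cos φ,
        -((x₀ * Real.exp (u φ)) ^ n * Real.sin φ)))
      (w := fun φ => γ (∫ ψ in φ₀..φ, T ψ)) hφ₀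
      (fun φ hφ => hasDerivAt_polar_curve hn (hu φ hφ) (hden φ hφ).ne) (fun φ hφ => ?_) hTc
      (fun φ hφ => ?_) ?_
    · exact fun φ hφ => (hE hφ).symm
    · have h1 : HasDerivAt γ (f₁ (γ (∫ ψ in φ₀..φ, T ψ)).1 (γ (∫ ψ in φ₀..φ, T ψ)).2,
          f₂ (γ (∫ ψ in φ₀..φ, T ψ)).1 (γ (∫ ψ in φ₀..φ, T ψ)).2) (∫ ψ in φ₀..φ, T ψ) :=
        (hγ _).1.prodMk (hγ _).2
      exact h1.scomp φ (ht φ hφ)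
    · have hm := h.norm_polar_lt hn φ (hr φ hφ).1 (hr φ hφ).2
      exact (h.contDiff₁ _ hm).prodMk (h.contDiff₂ _ hm)
    · simp only [intervalIntegral.integral_same, hγ₀]

end IsModelPerturbation

theorem Real.cos_le_of_mem_Icc {φ : ℝ} (h : φ ∈ Icc 1 (2 * Real.pi - 1)) :
    Real.cos φ ≤ 5 / 9 := by
  have hπ := Real.pi_gt_three
  refine le_trans ?_ Real.cos_one_le
  rcases le_total φ Real.pi with hle | hle
  · exact Real.cos_le_cos_of_nonneg_of_le_pi (by norm_num) hle h.1
  · rw [← Real.cos_two_pi_sub φ]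
    exact Real.cos_le_cos_of_nonneg_of_le_pi (by norm_num) (by linarith) (by linarith [h.2])

theorem abs_le_abs_sin_div_cos_pow (n : ℕ) (hn : 1 ≤ n) {ψ : ℝ} (h : |ψ| ≤ 1) :
    |ψ| ≤ |Real.sin ψ / Real.cos ψ ^ n| := by
  rw [abs_le] at h
  rcases le_total 0 ψ with h0 | h0
  · have := sub_le_sin_div_cos_pow_sub n hn (φ := 0) (ψ := ψ) (by norm_num) h0 h.2
    simp only [Real.sin_zero, zero_div, sub_zero] at this
    rw [abs_of_nonneg h0]
    exact this.trans (le_abs_self _)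
  · have := sub_le_sin_div_cos_pow_sub n hn (φ := ψ) (ψ := 0) h.1 h0 (by norm_num)
    simp only [Real.sin_zero, zero_div, zero_sub] at this
    rw [abs_of_nonpos h0]
    exact this.trans (neg_le_abs _)

theorem Real.abs_exp_sub_exp_le {U w w' : ℝ} (hw : |w| ≤ U) (hw' : |w'| ≤ U) :
    |Real.exp w - Real.exp w'| ≤ Real.exp U * |w - w'| := by
  have := (convex_Iic U).norm_image_sub_le_of_norm_deriv_le (f := Real.exp) (C := Real.exp U)
    (fun x _ => Real.differentiableAt_exp) (fun x hx => by
      rw [Real.deriv_exp, Real.norm_eq_abs, abs_of_pos (Real.exp_pos x)]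
      exact Real.exp_le_exp.2 hx) ((abs_le.1 hw').2) ((abs_le.1 hw).2)
  simpa using this

theorem abs_exp_mul_cos_sub_le {u : ℝ → ℝ} {U B φ ψ : ℝ} (hφ : |u φ| ≤ U) (hψ : |u ψ| ≤ U)
    (hB : |u φ - u ψ| ≤ B * |φ - ψ|) :
    |Real.exp (u φ) * Real.cos φ - Real.exp (u ψ) * Real.cos ψ| ≤
      Real.exp U * (B + 1) * |φ - ψ| := by
  have h1 := Real.abs_exp_sub_exp_le hφ hψ
  have h2 : |Real.cos φ - Real.cos ψ| ≤ |φ - ψ| := by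
    have := (convex_univ).norm_image_sub_le_of_norm_deriv_le (f := Real.cos) (C := 1)
      (fun x _ => Real.differentiableAt_cos) (fun x _ => by
        rw [Real.deriv_cos, Real.norm_eq_abs, abs_neg]
        exact Real.abs_sin_le_one x) (mem_univ ψ) (mem_univ φ)
    simpa using this
  have h3 : Real.exp (u φ) * Real.cos φ - Real.exp (u ψ) * Real.cos ψ =
      (Real.exp (u φ) - Real.exp (u ψ)) * Real.cos φ +
        Real.exp (u ψ) * (Real.cos φ - Real.cos ψ) := by ring
  rw [h3]
  refine (abs_add_le _ _).trans ?_
  rw [abs_mul, abs_mul, abs_of_pos (Real.exp_pos (u ψ))]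
  have h4 : |Real.exp (u φ) - Real.exp (u ψ)| * |Real.cos φ| ≤
      Real.exp U * (B * |φ - ψ|) * 1 := by
    refine mul_le_mul (h1.trans ?_) (Real.abs_cos_le_one φ) (abs_nonneg _) ?_
    · gcongr
    · exact mul_nonneg (Real.exp_pos U).le ((abs_nonneg _).trans hB)
  have h5 : Real.exp (u ψ) * |Real.cos φ - Real.cos ψ| ≤ Real.exp U * |φ - ψ| := by
    refine mul_le_mul (Real.exp_le_exp.2 (abs_le.1 hψ).2) h2 (abs_nonneg _) (Real.exp_pos U).le
  linarith

namespace IsModelPerturbation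

variable {n p : ℕ} {G : ℝ → ℝ → ℝ} {f₁ f₂ : ℝ → ℝ → ℝ} {F W : ℝ → ℝ} {κ A L C ρ ρ₀ : ℝ}

theorem mem_section_iff (h : IsModelPerturbation n p G f₁ f₂ F W C ρ) {r φ : ℝ} (hr : 0 < r)
    (hrρ : r < ρ) (hφ : 0 < Real.cos φ) :
    -(r ^ n * Real.sin φ) = F (r * Real.cos φ) ↔
      Real.sin φ / Real.cos φ ^ n = -W (r * Real.cos φ) := by
  have hx : 0 < r * Real.cos φ := mul_pos hr hφ
  have hxρ : r * Real.cos φ < ρ :=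
    (mul_le_of_le_one_right hr.le (Real.cos_le_one φ)).trans_lt hrρ
  rw [h.section_eq _ hx hxρ, mul_pow, div_eq_iff (pow_pos hφ n).ne']
  have := (pow_pos hr n).ne'
  constructor
  · intro e
    refine mul_left_cancel₀ this ?_
    linarith
  · intro e
    rw [e]
    ring

/-- After leaving the section, a polar trajectory does not meet it again before one full turn. -/
theorem abs_sub_two_pi_le_of_mem_section (h : IsModelPerturbation n p G f₁ f₂ F W C ρ)
    (hn : 1 ≤ n) {u : ℝ → ℝ} {x₀ U B φ₀ φ : ℝ} (hx₀ : 0 < x₀)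
    (hU : ∀ φ ∈ Icc (-1) (2 * Real.pi + 1), |u φ| ≤ U)
    (hB : ∀ φ ∈ Icc (-1) (2 * Real.pi + 1), ∀ ψ ∈ Icc (-1) (2 * Real.pi + 1),
      |u φ - u ψ| ≤ B * |φ - ψ|)
    (hR : x₀ * Real.exp U < ρ) (hhalf : C * (x₀ * Real.exp U) ^ p ≤ 1 / 2)
    (hone : C * (x₀ * (Real.exp U * (B + 1))) < 1)
    (hφ₀ : |φ₀| ≤ 1)
    (hs₀ : Real.sin φ₀ / Real.cos φ₀ ^ n = -W (x₀ * Real.exp (u φ₀) * Real.cos φ₀))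
    (hφ : φ₀ < φ) (hφ' : φ ≤ 2 * Real.pi + 1) (hc : 0 < Real.cos φ)
    (hs : Real.sin φ / Real.cos φ ^ n = -W (x₀ * Real.exp (u φ) * Real.cos φ)) :
    |φ - 2 * Real.pi| ≤ C * (x₀ * Real.exp U) ^ p := by
  have hπ := Real.pi_gt_three
  have hC := h.C_nonneg
  obtain ⟨h01, h02⟩ := abs_le.1 hφ₀
  have hmem₀ : φ₀ ∈ Icc (-1) (2 * Real.pi + 1) := ⟨h01, by linarith⟩
  have hmem : φ ∈ Icc (-1) (2 * Real.pi + 1) := ⟨by linarith, hφ'⟩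
  have hX : ∀ ψ ∈ Icc (-1) (2 * Real.pi + 1), 0 < Real.cos ψ →
      0 < x₀ * Real.exp (u ψ) * Real.cos ψ ∧
      x₀ * Real.exp (u ψ) * Real.cos ψ ≤ x₀ * Real.exp U := by
    intro ψ hψ hcψ
    refine ⟨by positivity, ?_⟩
    have : Real.exp (u ψ) ≤ Real.exp U := Real.exp_le_exp.2 (abs_le.1 (hU ψ hψ)).2
    refine (mul_le_of_le_one_right (by positivity) (Real.cos_le_one ψ)).trans ?_
    gcongr
  have hX1 := hX φ hmem hc
  have hW : |W (x₀ * Real.exp (u φ) * Real.cos φ)| ≤ C * (x₀ * Real.exp U) ^ p := by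
    refine (h.section_le _ hX1.1 (hX1.2.trans_lt hR)).trans ?_
    exact mul_le_mul_of_nonneg_left (pow_le_pow_left₀ hX1.1.le hX1.2 p) hC
  rcases lt_or_ge φ 1 with h1 | h1
  · exfalso
    have hX0 := hX φ₀ hmem₀ (Real.cos_pos_of_abs_le_one hφ₀)
    have e1 := sub_le_sin_div_cos_pow_sub n hn h01 hφ.le h1.le
    rw [hs, hs₀] at e1
    have e2 := h.section_lipschitz _ ⟨hX0.1, hX0.2.trans_lt hR⟩ _ ⟨hX1.1, hX1.2.trans_lt hR⟩
    have e3 := abs_exp_mul_cos_sub_le (hU φ₀ hmem₀) (hU φ hmem) (hB φ₀ hmem₀ φ hmem)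
    have e4 : |x₀ * Real.exp (u φ₀) * Real.cos φ₀ - x₀ * Real.exp (u φ) * Real.cos φ| ≤
        x₀ * (Real.exp U * (B + 1) * |φ₀ - φ|) := by
      rw [mul_assoc, mul_assoc, ← mul_sub, abs_mul, abs_of_pos hx₀]
      gcongr
    rw [abs_sub_comm φ₀ φ, abs_of_pos (sub_pos.2 hφ)] at e4
    have e5 := mul_le_mul_of_nonneg_left e4 hC
    have e6 := le_abs_self
      (W (x₀ * Real.exp (u φ₀) * Real.cos φ₀) - W (x₀ * Real.exp (u φ) * Real.cos φ))
    nlinarith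
  rcases lt_or_ge (2 * Real.pi - 1) φ with h2 | h2
  · have hψ : |φ - 2 * Real.pi| ≤ 1 := abs_le.2 ⟨by linarith, by linarith⟩
    have := abs_le_abs_sin_div_cos_pow n hn hψ
    rw [Real.sin_sub_two_pi, Real.cos_sub_two_pi, hs, abs_neg] at this
    exact this.trans hW
  · exfalso
    have e1 := Real.cos_le_of_mem_Icc ⟨h1, h2⟩
    have e2 := Real.sin_sq_add_cos_sq φ
    have e3 : 1 / 2 < |Real.sin φ| := by
      rw [← abs_of_pos (show (0 : ℝ) < 1 / 2 by norm_num), ← sq_lt_sq]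
      nlinarith
    have e4 : |Real.sin φ| ≤ |Real.sin φ / Real.cos φ ^ n| := by
      rw [abs_div, abs_of_pos (pow_pos hc n)]
      exact le_div_self (abs_nonneg _) (pow_pos hc n) (pow_le_one₀ hc.le (Real.cos_le_one φ))
    rw [hs, abs_neg] at e4
    linarith

/-- A polar trajectory meets the section near one full turn. -/
theorem exists_mem_section (h : IsModelPerturbation n p G f₁ f₂ F W C ρ) (hn : 1 ≤ n)
    {u : ℝ → ℝ} {x₀ U : ℝ} {θ : ℝ} (hθ : Real.sin θ = 0) (hθ' : Real.cos θ = 1) (hx₀ : 0 < x₀)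
    (huc : ContinuousOn u (Icc (θ - 1) (θ + 1)))
    (hU : ∀ φ ∈ Icc (θ - 1) (θ + 1), x₀ * Real.exp (u φ) * Real.cos φ ≤ x₀ * Real.exp U)
    (hR : x₀ * Real.exp U < ρ) (hhalf : C * (x₀ * Real.exp U) ^ p ≤ 1 / 2) :
    ∃ φ, |φ - θ| ≤ C * (x₀ * Real.exp U) ^ p ∧ 0 < Real.cos φ ∧
      Real.sin φ / Real.cos φ ^ n = -W (x₀ * Real.exp (u φ) * Real.cos φ) := by
  set η := C * (x₀ * Real.exp U) ^ p with hη
  have hC := h.C_nonneg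
  have hη0 : 0 ≤ η := by positivity
  have hsin : ∀ φ, Real.sin φ = Real.sin (φ - θ) := fun φ => by
    rw [Real.sin_sub, hθ, hθ']; ring
  have hcos : ∀ φ, Real.cos φ = Real.cos (φ - θ) := fun φ => by
    rw [Real.cos_sub, hθ, hθ']; ring
  have hsub : Icc (θ - η) (θ + η) ⊆ Icc (θ - 1) (θ + 1) :=
    Icc_subset_Icc (by linarith) (by linarith)
  have hc : ∀ φ ∈ Icc (θ - η) (θ + η), 0 < Real.cos φ := fun φ hφ => by
    rw [hcos]
    exact Real.cos_pos_of_abs_le_one (abs_le.2 ⟨by linarith [hφ.1], by linarith [hφ.2]⟩)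
  have hX : ∀ φ ∈ Icc (θ - η) (θ + η), x₀ * Real.exp (u φ) * Real.cos φ ∈ Ioo 0 ρ :=
    fun φ hφ => ⟨mul_pos (by positivity) (hc φ hφ), (hU φ (hsub hφ)).trans_lt hR⟩
  have hW : ∀ φ ∈ Icc (θ - η) (θ + η), |W (x₀ * Real.exp (u φ) * Real.cos φ)| ≤ η := by
    intro φ hφ
    refine (h.section_le _ (hX φ hφ).1 (hX φ hφ).2).trans ?_
    rw [hη]
    exact mul_le_mul_of_nonneg_left (pow_le_pow_left₀ (hX φ hφ).1.le (hU φ (hsub hφ)) p) hC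
  have hWc : ContinuousOn W (Ioo 0 ρ) := by
    have : LipschitzOnWith ⟨C, hC⟩ W (Ioo 0 ρ) :=
      LipschitzOnWith.of_dist_le_mul fun x hx y hy => h.section_lipschitz x hx y hy
    exact this.continuousOn
  have hEc : ContinuousOn (fun φ => Real.sin φ / Real.cos φ ^ n +
      W (x₀ * Real.exp (u φ) * Real.cos φ)) (Icc (θ - η) (θ + η)) := by
    have huc' := huc.mono hsub
    refine ContinuousOn.add (ContinuousOn.div (by fun_prop) (by fun_prop)
      fun φ hφ => (pow_pos (hc φ hφ) n).ne') (hWc.comp (by fun_prop) hX)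
  have hl : θ - η ∈ Icc (θ - η) (θ + η) := ⟨le_rfl, by linarith⟩
  have hr : θ + η ∈ Icc (θ - η) (θ + η) := ⟨by linarith, le_rfl⟩
  obtain ⟨φ, hφ, hφE⟩ := intermediate_value_Icc (by linarith : θ - η ≤ θ + η) hEc
    (show (0 : ℝ) ∈ Icc _ _ from ⟨by
      have e1 := sub_le_sin_div_cos_pow_sub n hn (φ := -η) (ψ := 0) (by linarith) (by linarith)
        (by norm_num)
      have e2 := (abs_le.1 (hW _ hl)).2
      have e3 : Real.sin (θ - η) / Real.cos (θ - η) ^ n = Real.sin (-η) / Real.cos (-η) ^ n := by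
        rw [hsin, hcos]; congr <;> ring
      simp only [Real.sin_zero, zero_div] at e1
      simp only [e3]
      linarith, by
      have e1 := sub_le_sin_div_cos_pow_sub n hn (φ := 0) (ψ := η) (by linarith) (by linarith)
        (by linarith)
      have e2 := (abs_le.1 (hW _ hr)).1
      have e3 : Real.sin (θ + η) / Real.cos (θ + η) ^ n = Real.sin η / Real.cos η ^ n := by
        rw [hsin, hcos]; congr <;> ring
      simp only [Real.sin_zero, zero_div] at e1
      simp only [e3]
      linarith⟩)
  refine ⟨φ, abs_le.2 ⟨by linarith [hφ.1], by linarith [hφ.2]⟩, hc φ hφ, ?_⟩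
  simp only at hφE
  linarith

end IsModelPerturbation

theorem Real.abs_log_cos_le {φ : ℝ} (h : |φ| ≤ 1) : |Real.log (Real.cos φ)| ≤ |φ| := by
  have hc := Real.cos_pos_of_abs_le_one h
  have h1 : 1 - φ ^ 2 / 2 ≤ Real.cos φ := Real.one_sub_sq_div_two_le_cos
  have h2 : φ ^ 2 ≤ |φ| := by
    rw [← sq_abs, sq]
    exact mul_le_of_le_one_left (abs_nonneg φ) h
  rw [abs_of_nonpos (Real.log_nonpos hc.le (Real.cos_le_one φ))]
  have h3 := Real.one_sub_inv_le_log_of_pos hc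
  have h4 : (Real.cos φ)⁻¹ ≤ 1 + |φ| := by
    rw [inv_le_comm₀ hc (by positivity)]
    refine le_trans ?_ h1
    rw [inv_le_iff_one_le_mul₀ (by positivity)]
    nlinarith [abs_nonneg φ]
  linarith

namespace IsModelPerturbation

variable {n p : ℕ} {G : ℝ → ℝ → ℝ} {f₁ f₂ : ℝ → ℝ → ℝ} {F W : ℝ → ℝ} {κ A L C ρ ρ₀ : ℝ}

/-- The polar coordinates of a point of the section. -/
theorem exists_polar_section_point (h : IsModelPerturbation n p G f₁ f₂ F W C ρ) (hn : 1 ≤ n)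
    {x₀ U : ℝ} (hx₀ : 0 < x₀) (hU : 0 ≤ U) (hR : x₀ * Real.exp U < ρ)
    (hhalf : C * (x₀ * Real.exp U) ^ p ≤ 1 / 2) :
    ∃ φ₀ u₀, |φ₀| ≤ C * (x₀ * Real.exp U) ^ p ∧ |u₀| ≤ |φ₀| ∧
      x₀ * Real.exp u₀ * Real.cos φ₀ = x₀ ∧
      Real.sin φ₀ / Real.cos φ₀ ^ n = -W x₀ ∧
      -((x₀ * Real.exp u₀) ^ n * Real.sin φ₀) = F x₀ := by
  have hcos : ∀ φ ∈ Icc ((0 : ℝ) - 1) (0 + 1), 0 < Real.cos φ := fun φ hφ =>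
    Real.cos_pos_of_abs_le_one (abs_le.2 ⟨by linarith [hφ.1], by linarith [hφ.2]⟩)
  have hcancel : ∀ φ ∈ Icc ((0 : ℝ) - 1) (0 + 1),
      x₀ * Real.exp (-Real.log (Real.cos φ)) * Real.cos φ = x₀ := fun φ hφ => by
    rw [Real.exp_neg, Real.exp_log (hcos φ hφ), mul_assoc, inv_mul_cancel₀ (hcos φ hφ).ne', mul_one]
  obtain ⟨φ, hφ, hc, hs⟩ := h.exists_mem_section hn (u := fun φ => -Real.log (Real.cos φ))
    Real.sin_zero Real.cos_zero hx₀
    (ContinuousOn.neg (ContinuousOn.log (by fun_prop) fun φ hφ => (hcos φ hφ).ne'))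
    (fun φ hφ => by
      rw [hcancel φ hφ]
      exact le_mul_of_one_le_right hx₀.le (Real.one_le_exp hU)) hR hhalf
  rw [sub_zero] at hφ
  have h1 : |φ| ≤ 1 := by linarith
  obtain ⟨h11, h12⟩ := abs_le.1 h1
  have hmem : φ ∈ Icc ((0 : ℝ) - 1) (0 + 1) := ⟨by linarith, by linarith⟩
  have hx₀ρ : x₀ < ρ := (le_mul_of_one_le_right hx₀.le (Real.one_le_exp hU)).trans_lt hR
  rw [hcancel φ hmem] at hs
  refine ⟨φ, -Real.log (Real.cos φ), hφ, by rw [abs_neg]; exact Real.abs_log_cos_le h1,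
    hcancel φ hmem, hs, ?_⟩
  rw [div_eq_iff (pow_pos hc n).ne'] at hs
  have h2 : x₀ ^ n = (x₀ * Real.exp (-Real.log (Real.cos φ))) ^ n * Real.cos φ ^ n := by
    rw [← mul_pow, hcancel φ hmem]
  rw [hs, h.section_eq x₀ hx₀ hx₀ρ, h2]
  ring

/-- The first return of a trajectory to the section is described, up to relative order `p`, by one
turn of a solution of the polar equation. -/
theorem exists_log_radius_of_trajectory (h : IsModelPerturbation n p G f₁ f₂ F W C ρ) (hn : 1 ≤ n)
    (hG : ModelBounds n G κ A L ρ₀) {x₀ U B : ℝ} (hx₀ : 0 < x₀) (hA : 0 ≤ A)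
    (hBdef : B = A / κ + 1) (hU : U = (A / κ + 1) * (2 * Real.pi + 2) + 1)
    (hR : x₀ * Real.exp U < ρ) (hR₀ : x₀ * Real.exp U ≤ ρ₀)
    (h₁ : (n + 2) * C * (x₀ * Real.exp U) ^ p ≤ κ / 2)
    (h₂ : (2 / κ + 2 * A / κ ^ 2) * ((n + 2) * C * (x₀ * Real.exp U) ^ p) ≤ 1)
    (hhalf : C * (x₀ * Real.exp U) ^ p ≤ 1 / 2)
    (hone : C * (x₀ * (Real.exp U * (B + 1))) < 1)
    {γ : ℝ → ℝ × ℝ} {τ : ℝ} (hγ₀ : γ 0 = (x₀, F x₀))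
    (hγ : ∀ t : ℝ, HasDerivAt (fun s => (γ s).1) (f₁ (γ t).1 (γ t).2) t ∧
        HasDerivAt (fun s => (γ s).2) (f₂ (γ t).1 (γ t).2) t)
    (hτ : 0 < τ) (hτγ : (γ τ).2 = F (γ τ).1 ∧ 0 < (γ τ).1)
    (hfirst : ∀ t : ℝ, 0 < t → t < τ → ¬((γ t).2 = F (γ t).1 ∧ 0 < (γ t).1)) :
    ∃ u : ℝ → ℝ, (∀ φ ∈ Icc (0 : ℝ) (2 * Real.pi), |u φ| ≤ U ∧
      HasDerivWithinAt u (polarSlope n f₁ f₂ φ (x₀ * Real.exp (u φ))) (Icc 0 (2 * Real.pi)) φ) ∧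
      |u 0| ≤ (B + 1) * (C * (x₀ * Real.exp U) ^ p) ∧
      |(γ τ).1 - x₀ * Real.exp (u (2 * Real.pi))| ≤
        x₀ * (Real.exp U * (B + 1) * (C * (x₀ * Real.exp U) ^ p)) := by
  have hπ := Real.pi_gt_three
  have hκ := hG.pos
  have hB1 : 0 ≤ B := by rw [hBdef]; positivity
  have hU0 : 0 ≤ U := by rw [hU]; positivity
  obtain ⟨φ₀, u₀, hφ₀, hu₀, hx, hs₀, hFx⟩ := h.exists_polar_section_point hn hx₀ hU0 hR hhalf
  have hφ₀1 : |φ₀| ≤ 1 := by linarith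
  obtain ⟨h01, h02⟩ := abs_le.1 (hφ₀.trans hhalf)
  have hmem₀ : φ₀ ∈ Icc (-1) (2 * Real.pi + 1) := ⟨by linarith, by linarith⟩
  obtain ⟨u, huφ₀, hu⟩ := h.exists_log_radius hn hG hx₀ hA hU hR hR₀ h₁ h₂ hmem₀
    (hu₀.trans hφ₀1)
  have hrle : ∀ φ ∈ Icc (-1) (2 * Real.pi + 1), x₀ * Real.exp (u φ) ≤ x₀ * Real.exp U :=
    fun φ hφ => mul_le_mul_of_nonneg_left
      (Real.exp_le_exp.2 (abs_le.1 (hu φ hφ).1).2) hx₀.le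
  have hbd := fun φ hφ => h.polarSlope_bounds hG (φ := φ) hφ (mul_pos hx₀ (Real.exp_pos (u φ)))
    (hrle φ hφ) hR hR₀ h₁ h₂
  have hLip : ∀ φ ∈ Icc (-1) (2 * Real.pi + 1), ∀ ψ ∈ Icc (-1) (2 * Real.pi + 1),
      |u φ - u ψ| ≤ B * |φ - ψ| := by
    intro φ hφ ψ hψ
    have := (convex_Icc (-1) (2 * Real.pi + 1)).norm_image_sub_le_of_norm_hasDerivWithin_le
      (f := u) (C := B) (fun x hx => (hu x hx).2)
      (fun x hx => by rw [Real.norm_eq_abs, hBdef]; exact (hbd x hx).2.2) hψ hφ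
    simpa using this
  have huc : ContinuousOn u (Icc (-1) (2 * Real.pi + 1)) := fun φ hφ =>
    (hu φ hφ).2.continuousWithinAt
  have hsub : Ioo (-1) (2 * Real.pi + 1) ⊆ Icc (-1) (2 * Real.pi + 1) := Ioo_subset_Icc_self
  obtain ⟨t, ht₀, htc, htm, htγ⟩ := h.exists_time_change hn (x₀ := x₀)
    (a := -1) (b := 2 * Real.pi + 1) (φ₀ := φ₀) ⟨by linarith, by linarith⟩ (u := u)
    (fun φ hφ => ⟨by positivity, (hrle φ (hsub hφ)).trans_lt hR⟩)
    (fun φ hφ => (hbd φ (hsub hφ)).1)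
    (fun φ hφ => (hu φ (hsub hφ)).2.hasDerivAt (Icc_mem_nhds hφ.1 hφ.2))
    (γ := γ) (by rw [huφ₀, hx, hγ₀, hFx]) hγ
  have hIcc : Icc (2 * Real.pi - 1) (2 * Real.pi + 1) ⊆ Icc (-1) (2 * Real.pi + 1) :=
    Icc_subset_Icc (by linarith) le_rfl
  obtain ⟨φ₁, hφ₁, hc₁, hs₁⟩ := h.exists_mem_section hn (u := u) (x₀ := x₀) (U := U)
    Real.sin_two_pi Real.cos_two_pi hx₀ (huc.mono hIcc)
    (fun φ hφ => (mul_le_of_le_one_right (by positivity) (Real.cos_le_one φ)).trans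
      (hrle φ (hIcc hφ))) hR hhalf
  obtain ⟨h11, h12⟩ := abs_le.1 (hφ₁.trans hhalf)
  have hmem₁ : φ₁ ∈ Ioo (-1) (2 * Real.pi + 1) := ⟨by linarith, by linarith⟩
  have hmem₀' : φ₀ ∈ Ioo (-1) (2 * Real.pi + 1) := ⟨by linarith, by linarith⟩
  have h01 : φ₀ < φ₁ := by linarith
  have ht₁ : 0 < t φ₁ := by
    rw [← ht₀]
    exact htm hmem₀' hmem₁ h01
  have hτ₁ : τ ≤ t φ₁ := by
    by_contra! hlt
    refine hfirst _ ht₁ hlt ?_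
    rw [htγ φ₁ hmem₁]
    exact ⟨(h.mem_section_iff (by positivity) ((hrle φ₁ (hsub hmem₁)).trans_lt hR) hc₁).2 hs₁,
      mul_pos (by positivity) hc₁⟩
  obtain ⟨φ₂, hφ₂, htφ₂⟩ := intermediate_value_Icc h01.le
    (htc.mono fun x hx => ⟨hmem₀'.1.trans_le hx.1, hx.2.trans_lt hmem₁.2⟩)
    (show τ ∈ Icc _ _ from ⟨by rw [ht₀]; exact hτ.le, hτ₁⟩)
  have hmem₂ : φ₂ ∈ Ioo (-1) (2 * Real.pi + 1) :=
    ⟨hmem₀'.1.trans_le hφ₂.1, hφ₂.2.trans_lt hmem₁.2⟩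
  have hlt₂ : φ₀ < φ₂ := by
    refine lt_of_le_of_ne hφ₂.1 fun e => ?_
    rw [← e, ht₀] at htφ₂
    exact hτ.ne htφ₂
  rw [← htφ₂, htγ φ₂ hmem₂] at hτγ
  have hc₂ : 0 < Real.cos φ₂ := pos_of_mul_pos_right hτγ.2 (by positivity)
  have hs₂ := (h.mem_section_iff (by positivity) ((hrle φ₂ (hsub hmem₂)).trans_lt hR) hc₂).1 hτγ.1
  have hφ₂π := h.abs_sub_two_pi_le_of_mem_section hn hx₀ (fun φ hφ => (hu φ hφ).1) hLip hR hhalf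
    hone hφ₀1 (by rw [huφ₀, hx]; exact hs₀) hlt₂ hmem₂.2.le hc₂ hs₂
  have hsub' : Icc 0 (2 * Real.pi) ⊆ Icc (-1) (2 * Real.pi + 1) :=
    Icc_subset_Icc (by linarith) (by linarith)
  have hmemπ : 2 * Real.pi ∈ Icc (-1) (2 * Real.pi + 1) := ⟨by linarith, by linarith⟩
  refine ⟨u, fun φ hφ => ⟨(hu φ (hsub' hφ)).1, (hu φ (hsub' hφ)).2.mono hsub'⟩, ?_, ?_⟩
  · have e1 := hLip 0 ⟨by linarith, by linarith⟩ φ₀ hmem₀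
    rw [huφ₀, zero_sub, abs_neg] at e1
    have e2 := abs_sub_abs_le_abs_sub (u 0) u₀
    have e3 := mul_le_mul_of_nonneg_left hφ₀ hB1
    linarith
  · have e1 := abs_exp_mul_cos_sub_le (hu φ₂ (hsub hmem₂)).1 (hu _ hmemπ).1
      (hLip φ₂ (hsub hmem₂) _ hmemπ)
    rw [Real.cos_two_pi, mul_one] at e1
    rw [← htφ₂, htγ φ₂ hmem₂, mul_assoc, ← mul_sub, abs_mul, abs_of_pos hx₀]
    refine mul_le_mul_of_nonneg_left (e1.trans ?_) hx₀.le
    exact mul_le_mul_of_nonneg_left hφ₂π (by positivity)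

/-- Near the origin, the return map of a perturbation of the model is described, up to relative
order `p`, by an approximate solution over one turn of the polar equation of the model. -/
theorem eventually_exists_log_radius (h : IsModelPerturbation n p G f₁ f₂ F W C ρ) (hn : 1 ≤ n)
    (hp : 1 ≤ p) (hG : ModelBounds n G κ A L ρ₀) (hA : 0 ≤ A) (hρ₀ : 0 < ρ₀) {U : ℝ}
    (hU : U = (A / κ + 1) * (2 * Real.pi + 2) + 1) {P : ℝ → ℝ} (hP : IsReturnMap f₁ f₂ F P) :
    ∃ K, 0 ≤ K ∧ ∀ᶠ x₀ in 𝓝[>] (0 : ℝ), x₀ * Real.exp U ≤ ρ₀ ∧ ∃ u u' : ℝ → ℝ,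
      (∀ φ ∈ Icc (0 : ℝ) (2 * Real.pi), |u φ| ≤ U ∧
        HasDerivWithinAt u (u' φ) (Icc 0 (2 * Real.pi)) φ ∧
        |u' φ - modelSlope n G φ (x₀ * Real.exp (u φ))| ≤ K * x₀ ^ p) ∧
      |u 0| ≤ K * x₀ ^ p ∧ |P x₀ - x₀ * Real.exp (u (2 * Real.pi))| ≤ K * x₀ ^ (p + 1) := by
  have hπ := Real.pi_gt_three
  have hκ := hG.pos
  have hC := h.C_nonneg
  obtain ⟨-, ε, hε, hP⟩ := hP
  set B := A / κ + 1 with hB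
  have hB0 : 0 ≤ B := by positivity
  set E := Real.exp U
  have hE : 0 < E := Real.exp_pos U
  set K₁ := (2 / κ + 2 * A / κ ^ 2) * ((n + 2) * (C * E ^ p)) with hK₁
  set K₂ := (B + 1) * (C * E ^ p) with hK₂
  set K₃ := E * (B + 1) * (C * E ^ p) with hK₃
  have hK₁0 : 0 ≤ K₁ := by positivity
  have hK₂0 : 0 ≤ K₂ := by positivity
  have hK₃0 : 0 ≤ K₃ := by positivity
  refine ⟨K₁ + K₂ + K₃, by positivity, ?_⟩
  have small : ∀ {f : ℝ → ℝ} {c : ℝ}, Continuous f → f 0 < c → ∀ᶠ x in 𝓝[>] (0 : ℝ), f x < c :=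
    fun hf h0 => (hf.continuousAt.eventually_lt_const h0).filter_mono nhdsWithin_le_nhds
  have hp0 : p ≠ 0 := by omega
  filter_upwards [self_mem_nhdsWithin, small (f := fun x => |x|) (by fun_prop) (by simpa using hε),
    small (f := fun x => x * E) (by fun_prop) (by simpa using h.pos),
    small (f := fun x => x * E) (by fun_prop) (by simpa using hρ₀),
    small (f := fun x => (n + 2) * C * (x * E) ^ p) (c := κ / 2) (by fun_prop)
      (by simpa [hp0] using hκ),
    small (f := fun x => (2 / κ + 2 * A / κ ^ 2) * ((n + 2) * C * (x * E) ^ p)) (c := 1)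
      (by fun_prop) (by simp [hp0]),
    small (f := fun x => C * (x * E) ^ p) (c := 1 / 2) (by fun_prop) (by simp [hp0]),
    small (f := fun x => C * (x * (E * (B + 1)))) (c := 1) (by fun_prop) (by simp)]
    with x₀ hx₀ hxε hR hR₀ h₁ h₂ hhalf hone
  have hx₀ : 0 < x₀ := hx₀
  obtain ⟨γ, hγ₀, hγ, τ, hτ, hτγ, hfirst, hPx⟩ := hP x₀ hx₀.ne' hxε
  simp only [mul_pos_iff_of_pos_left hx₀] at hτγ hfirst
  obtain ⟨u, hu, hu0, huπ⟩ := h.exists_log_radius_of_trajectory hn hG hx₀ hA hB hU hR hR₀.le h₁.le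
    h₂.le hhalf.le hone hγ₀ hγ hτ hτγ hfirst
  have hq : 0 < x₀ ^ p := pow_pos hx₀ p
  refine ⟨hR₀.le, u, fun φ => polarSlope n f₁ f₂ φ (x₀ * Real.exp (u φ)), fun φ hφ =>
    ⟨(hu φ hφ).1, (hu φ hφ).2, ?_⟩, ?_, ?_⟩
  · have hmem : φ ∈ Icc (-1) (2 * Real.pi + 1) := ⟨by linarith [hφ.1], by linarith [hφ.2]⟩
    refine (h.polarSlope_bounds hG hmem (mul_pos hx₀ (Real.exp_pos (u φ)))
      (mul_le_mul_of_nonneg_left (Real.exp_le_exp.2 (abs_le.1 (hu φ hφ).1).2) hx₀.le) hR hR₀.le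
      h₁.le h₂.le).2.1.trans ?_
    have : (2 / κ + 2 * A / κ ^ 2) * ((n + 2) * C * (x₀ * E) ^ p) = K₁ * x₀ ^ p := by
      rw [hK₁, mul_pow]; ring
    rw [this]
    exact mul_le_mul_of_nonneg_right (by linarith) hq.le
  · refine hu0.trans ?_
    have : (B + 1) * (C * (x₀ * E) ^ p) = K₂ * x₀ ^ p := by
      rw [hK₂, mul_pow]; ring
    rw [this]
    exact mul_le_mul_of_nonneg_right (by linarith) hq.le
  · rw [hPx]
    refine huπ.trans ?_
    have : x₀ * (E * (B + 1) * (C * (x₀ * E) ^ p)) = K₃ * x₀ ^ (p + 1) := by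
      rw [hK₃, mul_pow]; ring
    rw [this]
    exact mul_le_mul_of_nonneg_right (by linarith) (pow_pos hx₀ _).le

end IsModelPerturbation

/-- Approximate solutions over one turn of the polar equation of the model remain close. -/
theorem ModelBounds.abs_sub_le_of_approx_solutions {n : ℕ} {G : ℝ → ℝ → ℝ} {κ A L ρ₀ : ℝ}
    (hG : ModelBounds n G κ A L ρ₀) (hρ₀ : 0 < ρ₀) {x₀ U e : ℝ} (hx₀ : 0 < x₀)
    (hR₀ : x₀ * Real.exp U ≤ ρ₀) {u u' w w' : ℝ → ℝ}
    (hu : ∀ φ ∈ Icc (0 : ℝ) (2 * Real.pi), |u φ| ≤ U ∧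
      HasDerivWithinAt u (u' φ) (Icc 0 (2 * Real.pi)) φ ∧
      |u' φ - modelSlope n G φ (x₀ * Real.exp (u φ))| ≤ e)
    (hw : ∀ φ ∈ Icc (0 : ℝ) (2 * Real.pi), |w φ| ≤ U ∧
      HasDerivWithinAt w (w' φ) (Icc 0 (2 * Real.pi)) φ ∧
      |w' φ - modelSlope n G φ (x₀ * Real.exp (w φ))| ≤ e)
    (h0 : |u 0 - w 0| ≤ 2 * e) :
    |u (2 * Real.pi) - w (2 * Real.pi)| ≤ gronwallBound 2 (|L| * ρ₀ + 1) 2 (2 * Real.pi) * e := by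
  have hπ := Real.pi_gt_three
  obtain ⟨K, hK⟩ : ∃ K : ℝ≥0, (K : ℝ) = |L| * ρ₀ + 1 := ⟨⟨_, by positivity⟩, rfl⟩
  have hmem : ∀ y ∈ Icc (-U) U, x₀ * Real.exp y ∈ Icc 0 ρ₀ := fun y hy =>
    ⟨by positivity, (mul_le_mul_of_nonneg_left (Real.exp_le_exp.2 hy.2) hx₀.le).trans hR₀⟩
  have hv : ∀ φ ∈ Ico 0 (2 * Real.pi), LipschitzOnWith K
      (fun y => modelSlope n G φ (x₀ * Real.exp y)) (Icc (-U) U) := by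
    intro φ hφ
    refine LipschitzOnWith.of_dist_le_mul fun y hy z hz => ?_
    rw [Real.dist_eq, Real.dist_eq, hK]
    refine (hG.lipschitz φ ⟨by linarith [hφ.1], by linarith [hφ.2]⟩ _ (hmem y hy) _
      (hmem z hz)).trans ?_
    rw [← mul_sub, abs_mul, abs_of_pos hx₀]
    have h1 := Real.abs_exp_sub_exp_le (abs_le.2 hy) (abs_le.2 hz)
    calc L * (x₀ * |Real.exp y - Real.exp z|) ≤ |L| * (x₀ * (Real.exp U * |y - z|)) := by
          have := le_abs_self L
          gcongr
      _ = |L| * (x₀ * Real.exp U) * |y - z| := by ring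
      _ ≤ |L| * ρ₀ * |y - z| := by gcongr
      _ ≤ (|L| * ρ₀ + 1) * |y - z| := by gcongr; linarith
  have hIci : ∀ {f : ℝ → ℝ} {f' φ : ℝ}, φ ∈ Ico 0 (2 * Real.pi) →
      HasDerivWithinAt f f' (Icc 0 (2 * Real.pi)) φ → HasDerivWithinAt f f' (Ici φ) φ :=
    fun hφ hf => hf.mono_of_mem_nhdsWithin (Icc_mem_nhdsGE_of_mem hφ)
  have key := dist_le_of_approx_trajectories_ODE_of_mem (f' := u') (g' := w') hv
    (fun φ hφ => (hu φ hφ).2.1.continuousWithinAt)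
    (fun φ hφ => hIci hφ (hu φ (Ico_subset_Icc_self hφ)).2.1)
    (fun φ hφ => (hu φ (Ico_subset_Icc_self hφ)).2.2)
    (fun φ hφ => abs_le.1 (hu φ (Ico_subset_Icc_self hφ)).1)
    (fun φ hφ => (hw φ hφ).2.1.continuousWithinAt)
    (fun φ hφ => hIci hφ (hw φ (Ico_subset_Icc_self hφ)).2.1)
    (fun φ hφ => (hw φ (Ico_subset_Icc_self hφ)).2.2)
    (fun φ hφ => abs_le.1 (hw φ (Ico_subset_Icc_self hφ)).1)
    h0 (2 * Real.pi) ⟨by linarith, le_rfl⟩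
  rw [Real.dist_eq, sub_zero, hK] at key
  refine key.trans_eq ?_
  have hK0 : |L| * ρ₀ + 1 ≠ 0 := by positivity
  rw [gronwallBound_of_K_ne_0 hK0, gronwallBound_of_K_ne_0 hK0]
  ring

/-- The return maps of two perturbations of the same model agree up to relative order `p`. -/
theorem IsReturnMap.eventually_abs_sub_le {n p : ℕ} {G : ℝ → ℝ → ℝ} {κ A L ρ₀ : ℝ}
    (hn : 1 ≤ n) (hp : 1 ≤ p) (hG : ModelBounds n G κ A L ρ₀) (hA : 0 ≤ A) (hρ₀ : 0 < ρ₀)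
    {f₁ f₂ g₁ g₂ : ℝ → ℝ → ℝ} {F W F' W' P Q : ℝ → ℝ} {C ρ C' ρ' : ℝ}
    (hf : IsModelPerturbation n p G f₁ f₂ F W C ρ) (hg : IsModelPerturbation n p G g₁ g₂ F' W' C' ρ')
    (hP : IsReturnMap f₁ f₂ F P) (hQ : IsReturnMap g₁ g₂ F' Q) :
    ∃ K, ∀ᶠ x in 𝓝[>] (0 : ℝ), |P x - Q x| ≤ K * x ^ (p + 1) := by
  have hπ := Real.pi_gt_three
  obtain ⟨U, hU⟩ : ∃ U, U = (A / κ + 1) * (2 * Real.pi + 2) + 1 := ⟨_, rfl⟩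
  obtain ⟨K, hK, h1⟩ := hf.eventually_exists_log_radius hn hp hG hA hρ₀ hU hP
  obtain ⟨K', hK', h2⟩ := hg.eventually_exists_log_radius hn hp hG hA hρ₀ hU hQ
  refine ⟨(K + K') +
    Real.exp U * (gronwallBound 2 (|L| * ρ₀ + 1) 2 (2 * Real.pi) * (K + K')), ?_⟩
  filter_upwards [self_mem_nhdsWithin, h1, h2] with x₀ hx₀ h1 h2
  have hx₀ : 0 < x₀ := hx₀
  obtain ⟨hR₀, u, u', hu, hu0, huP⟩ := h1
  obtain ⟨-, w, w', hw, hw0, hwQ⟩ := h2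
  have hq : 0 < x₀ ^ p := pow_pos hx₀ p
  have k1 : K * x₀ ^ p ≤ (K + K') * x₀ ^ p := by gcongr; linarith
  have k2 : K' * x₀ ^ p ≤ (K + K') * x₀ ^ p := by gcongr; linarith
  have hmem : 2 * Real.pi ∈ Icc 0 (2 * Real.pi) := ⟨by linarith, le_rfl⟩
  have e1 := hG.abs_sub_le_of_approx_solutions hρ₀ hx₀ hR₀ (e := (K + K') * x₀ ^ p)
    (fun φ hφ => ⟨(hu φ hφ).1, (hu φ hφ).2.1, (hu φ hφ).2.2.trans k1⟩)
    (fun φ hφ => ⟨(hw φ hφ).1, (hw φ hφ).2.1, (hw φ hφ).2.2.trans k2⟩)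
    (by
      have := abs_sub (u 0) (w 0)
      linarith)
  have e2 := (Real.abs_exp_sub_exp_le (hu _ hmem).1 (hw _ hmem).1).trans
    (mul_le_mul_of_nonneg_left e1 (Real.exp_pos U).le)
  have e3 : |x₀ * Real.exp (u (2 * Real.pi)) - x₀ * Real.exp (w (2 * Real.pi))| ≤
      x₀ * (Real.exp U *
        (gronwallBound 2 (|L| * ρ₀ + 1) 2 (2 * Real.pi) * ((K + K') * x₀ ^ p))) := by
    rw [← mul_sub, abs_mul, abs_of_pos hx₀]
    exact mul_le_mul_of_nonneg_left e2 hx₀.le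
  have e4 := abs_le.1 huP
  have e5 := abs_le.1 hwQ
  have e6 := abs_le.1 e3
  have e7 : (K + K' + Real.exp U * (gronwallBound 2 (|L| * ρ₀ + 1) 2 (2 * Real.pi) * (K + K'))) *
      x₀ ^ (p + 1) = K * x₀ ^ (p + 1) + K' * x₀ ^ (p + 1) + x₀ * (Real.exp U *
        (gronwallBound 2 (|L| * ρ₀ + 1) 2 (2 * Real.pi) * ((K + K') * x₀ ^ p))) := by
    ring
  rw [e7, abs_le]
  constructor <;> linarith [e4.1, e4.2, e5.1, e5.2, e6.1, e6.2]

theorem exists_modelBounds {n : ℕ} {G : ℝ → ℝ → ℝ}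
    (hG : ContDiff ℝ 1 (fun q : ℝ × ℝ => G q.1 q.2))
    (hpos : ∀ φ, 0 < Real.cos φ * G φ 0 + n * Real.sin φ ^ 2) :
    ∃ κ A L ρ, 0 ≤ A ∧ 0 < ρ ∧ ModelBounds n G κ A L ρ := by
  set I := Icc (-1) (2 * Real.pi + 1)
  have hI : IsCompact I := isCompact_Icc
  set N : ℝ × ℝ → ℝ := fun q => Real.sin q.1 * G q.1 q.2 - Real.cos q.1 * Real.sin q.1 with hN
  set D : ℝ × ℝ → ℝ := fun q => Real.cos q.1 * G q.1 q.2 + n * Real.sin q.1 ^ 2 with hD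
  have hsin : ContDiff ℝ 1 (fun q : ℝ × ℝ => Real.sin q.1) := Real.contDiff_sin.comp contDiff_fst
  have hcos : ContDiff ℝ 1 (fun q : ℝ × ℝ => Real.cos q.1) := Real.contDiff_cos.comp contDiff_fst
  have hNc : ContDiff ℝ 1 N := (hsin.mul hG).sub (hcos.mul hsin)
  have hDc : ContDiff ℝ 1 D := (hcos.mul hG).add (contDiff_const.mul (hsin.pow 2))
  obtain ⟨u, v, -, hv, hIu, hv0, huv⟩ := generalized_tube_lemma hI (isCompact_singleton (x := (0 : ℝ)))
    (isOpen_lt continuous_const hDc.continuous : IsOpen {q | 0 < D q})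
    (fun q hq => by
      obtain ⟨φ, r⟩ := q
      obtain rfl : r = 0 := hq.2
      exact hpos φ)
  obtain ⟨ρ, hρ, hρv⟩ := Metric.isOpen_iff.1 hv 0 (hv0 rfl)
  set S := I ×ˢ Icc 0 (ρ / 2)
  have hS : IsCompact S := hI.prod isCompact_Icc
  have hSne : S.Nonempty := ⟨(0, 0), ⟨⟨by norm_num, by positivity⟩, ⟨le_rfl, by positivity⟩⟩⟩
  have hDpos : ∀ q ∈ S, 0 < D q := fun q hq => huv ⟨hIu hq.1, hρv (by
    rw [mem_ball, Real.dist_eq, sub_zero, abs_of_nonneg hq.2.1]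
    linarith [hq.2.2])⟩
  obtain ⟨q₀, hq₀, hmin⟩ := hS.exists_isMinOn hSne hDc.continuous.continuousOn
  obtain ⟨A, hA⟩ := hS.exists_bound_of_continuousOn hNc.continuous.continuousOn
  obtain ⟨L, hL⟩ := ContDiffOn.exists_lipschitzOnWith (f := fun q => N q / D q) (n := 1)
    (hNc.contDiffOn.div hDc.contDiffOn fun q hq => (hDpos q hq).ne') one_ne_zero
    ((convex_Icc _ _).prod (convex_Icc _ _)) hS
  have hmem : ∀ φ ∈ I, ∀ r ∈ Icc 0 (ρ / 2), (φ, r) ∈ S := fun φ hφ r hr => mk_mem_prod hφ hr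
  refine ⟨D q₀, A, L, ρ / 2, (norm_nonneg _).trans (hA q₀ hq₀), half_pos hρ, ?_⟩
  constructor
  · exact hDpos q₀ hq₀
  · exact fun φ hφ r hr => isMinOn_iff.1 hmin _ (hmem φ hφ r hr)
  · intro φ hφ r hr
    have := hA _ (hmem φ hφ r hr)
    rwa [Real.norm_eq_abs] at this
  · intro φ hφ r hr r' hr'
    have := hL.dist_le_mul _ (hmem φ hφ r hr) _ (hmem φ hφ r' hr')
    rwa [Prod.dist_eq, dist_self, max_eq_right dist_nonneg, Real.dist_eq, Real.dist_eq] at this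

/-- The factor `G` of the Liénard system `x' = y`, `y' = -∑ aⱼ xʲ - y ∑ bⱼ xʲ`, whose second
component is `-r^(2n-1) G(φ, r)` in quasi-homogeneous polar coordinates. -/
noncomputable def lienardModel (n M : ℕ) (a b : ℕ → ℝ) (φ r : ℝ) : ℝ :=
  (∑ j ∈ Finset.Icc (2 * n - 1) M, a j * r ^ (j - (2 * n - 1)) * Real.cos φ ^ j) -
    Real.sin φ * ∑ j ∈ Finset.Icc (n - 1) (M - 1), b j * r ^ (j - (n - 1)) * Real.cos φ ^ j

theorem contDiff_lienardModel (n M : ℕ) (a b : ℕ → ℝ) :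
    ContDiff ℝ 1 (fun q : ℝ × ℝ => lienardModel n M a b q.1 q.2) := by
  have hsin : ContDiff ℝ 1 (fun q : ℝ × ℝ => Real.sin q.1) := Real.contDiff_sin.comp contDiff_fst
  have hcos : ContDiff ℝ 1 (fun q : ℝ × ℝ => Real.cos q.1) := Real.contDiff_cos.comp contDiff_fst
  unfold lienardModel
  refine ContDiff.sub (ContDiff.sum fun j _ => ?_) (hsin.mul (ContDiff.sum fun j _ => ?_)) <;>
    exact (contDiff_const.mul (contDiff_snd.pow _)).mul (hcos.pow _)

theorem lienardModel_zero_right {n M : ℕ} (hn : 1 ≤ n) (hM : 2 * n - 1 < M) (a b : ℕ → ℝ) (φ : ℝ) :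
    lienardModel n M a b φ 0 = a (2 * n - 1) * Real.cos φ ^ (2 * n - 1) -
      Real.sin φ * (b (n - 1) * Real.cos φ ^ (n - 1)) := by
  have key : ∀ (c : ℕ → ℝ) (l m : ℕ), l ≤ m →
      ∑ j ∈ Finset.Icc l m, c j * 0 ^ (j - l) * Real.cos φ ^ j = c l * Real.cos φ ^ l := by
    intro c l m hlm
    rw [Finset.sum_eq_single_of_mem l (Finset.mem_Icc.2 ⟨le_rfl, hlm⟩)]
    · simp
    · intro j hj hjl
      have := (Finset.mem_Icc.1 hj).1
      rw [zero_pow (by omega)]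
      ring
  rw [lienardModel, key a _ _ hM.le, key b _ _ (by omega)]

theorem lienardModel_denom_pos {n M : ℕ} (hn : 1 ≤ n) (hM : 2 * n - 1 < M) {a b : ℕ → ℝ}
    (ha : 0 < a (2 * n - 1)) (hab : b (n - 1) ^ 2 - 4 * n * a (2 * n - 1) < 0) (φ : ℝ) :
    0 < Real.cos φ * lienardModel n M a b φ 0 + n * Real.sin φ ^ 2 := by
  rw [lienardModel_zero_right hn hM]
  obtain ⟨l, rfl⟩ : ∃ l, n = l + 1 := ⟨n - 1, by omega⟩
  have hl : 2 * (l + 1) - 1 = 2 * l + 1 := by omega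
  rw [hl] at ha hab ⊢
  rw [Nat.add_sub_cancel] at hab ⊢
  have e : Real.cos φ * (a (2 * l + 1) * Real.cos φ ^ (2 * l + 1) -
      Real.sin φ * (b l * Real.cos φ ^ l)) + (l + 1 : ℕ) * Real.sin φ ^ 2 =
      a (2 * l + 1) * (Real.cos φ ^ (l + 1)) ^ 2 - b l * (Real.cos φ ^ (l + 1)) * Real.sin φ +
        (l + 1 : ℕ) * Real.sin φ ^ 2 := by
    ring
  rw [e]
  have hn0 : (0 : ℝ) < (l + 1 : ℕ) := by positivity
  by_cases hc : Real.cos φ = 0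
  · have hs := Real.sin_sq_add_cos_sq φ
    rw [hc, zero_pow two_ne_zero, add_zero] at hs
    rw [hc, hs]
    simpa using hn0
  · have hw : 0 < (Real.cos φ ^ (l + 1)) ^ 2 := by positivity
    have h1 := mul_pos (sub_pos.2 (sub_neg.1 hab)) hw
    nlinarith [sq_nonneg (2 * (l + 1 : ℕ) * Real.sin φ - b l * Real.cos φ ^ (l + 1))]

theorem lienard_eq_lienardModel {n M : ℕ} (hn : 1 ≤ n) (a b : ℕ → ℝ) (φ r : ℝ) :
    -(∑ j ∈ Finset.Icc (2 * n - 1) M, a j * (r * Real.cos φ) ^ j) -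
        -(r ^ n * Real.sin φ) * ∑ j ∈ Finset.Icc (n - 1) (M - 1), b j * (r * Real.cos φ) ^ j =
      -(r ^ (n - 1) * r ^ n * lienardModel n M a b φ r) := by
  have key : ∀ (c : ℕ → ℝ) (l m : ℕ), ∑ j ∈ Finset.Icc l m, c j * (r * Real.cos φ) ^ j =
      r ^ l * ∑ j ∈ Finset.Icc l m, c j * r ^ (j - l) * Real.cos φ ^ j := by
    intro c l m
    rw [Finset.mul_sum]
    refine Finset.sum_congr rfl fun j hj => ?_
    have : r ^ j = r ^ l * r ^ (j - l) := by
      rw [← pow_add, Nat.add_sub_cancel' (Finset.mem_Icc.1 hj).1]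
    rw [mul_pow, this]
    ring
  have hr : r ^ (2 * n - 1) = r ^ (n - 1) * r ^ n := by
    rw [← pow_add]
    congr 1
    omega
  rw [key, key, lienardModel, hr]
  ring

/-- A section given by an analytic function of high order is a multiple of `xⁿ` by a small
Lipschitz factor. -/
theorem AnalyticAt.exists_section_factor {F : ℝ → ℝ} (hF : AnalyticAt ℝ F 0) {n p : ℕ}
    {K : ℝ} (h : ∀ᶠ x in 𝓝[>] (0 : ℝ), |F x| ≤ K * x ^ (n + p)) :
    ∃ W : ℝ → ℝ, ∃ C, 0 ≤ C ∧ ∃ ρ > 0, (∀ x ∈ Ioo 0 ρ, F x = x ^ n * W x ∧ |W x| ≤ C * x ^ p) ∧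
      ∀ x ∈ Ioo 0 ρ, ∀ y ∈ Ioo 0 ρ, |W x - W y| ≤ C * |x - y| := by
  obtain ⟨g, hg, hFg⟩ := (natCast_le_analyticOrderAt hF).1 (hF.le_analyticOrderAt_of_abs_le h)
  have hW : AnalyticAt ℝ (fun x => x ^ p * g x) 0 := (analyticAt_id.pow p).mul hg
  obtain ⟨L, t, ht, hL⟩ := (hW.contDiffAt (n := 1)).exists_lipschitzOnWith
  have hb : ∀ᶠ x in 𝓝 (0 : ℝ), |g x| < |g 0| + 1 :=
    hg.continuousAt.abs.eventually_lt_const (lt_add_one _)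
  obtain ⟨ρ, hρ, hball⟩ := Metric.eventually_nhds_iff_ball.1 ((hFg.and hb).and ht)
  have hmem : ∀ x ∈ Ioo 0 ρ, x ∈ ball (0 : ℝ) ρ := fun x hx => by
    rw [mem_ball, Real.dist_eq, sub_zero, abs_of_pos hx.1]
    exact hx.2
  refine ⟨fun x => x ^ p * g x, |g 0| + 1 + L, by positivity, ρ, hρ, fun x hx => ⟨?_, ?_⟩,
    fun x hx y hy => ?_⟩
  · rw [(hball x (hmem x hx)).1.1, sub_zero, smul_eq_mul, pow_add]
    ring
  · have h1 := (hball x (hmem x hx)).1.2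
    have h2 : 0 < x ^ p := pow_pos hx.1 p
    rw [abs_mul, abs_of_pos h2, mul_comm]
    refine mul_le_mul_of_nonneg_right ?_ h2.le
    linarith [L.coe_nonneg]
  · refine (hL.dist_le_mul x (hball x (hmem x hx)).2 y (hball y (hmem y hy)).2).trans ?_
    rw [Real.dist_eq]
    refine mul_le_mul_of_nonneg_right ?_ (abs_nonneg _)
    linarith [abs_nonneg (g 0)]

/-- If `F` solves `F + X(x, F) = 0` then `F` is as small as `X`. -/
theorem isBigO_of_add_eq_zero {F : ℝ → ℝ} {X : ℝ → ℝ → ℝ} {N : ℕ} (hF : DifferentiableAt ℝ F 0)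
    (hF0 : F 0 = 0)
    (hX : (fun q : ℝ × ℝ => X q.1 q.2) =O[𝓝 (0 : ℝ × ℝ)] fun q => ‖q‖ ^ N)
    (h : ∀ᶠ x in 𝓝 (0 : ℝ), F x + X x (F x) = 0) :
    F =O[𝓝 (0 : ℝ)] fun x => x ^ N := by
  have hFO : F =O[𝓝 (0 : ℝ)] fun x => x := by
    have := hF.isBigO_sub
    simpa [hF0] using this
  have hq : (fun x => (x, F x)) =O[𝓝 (0 : ℝ)] fun x => x :=
    (Asymptotics.isBigO_refl _ _).prod_left hFO
  have ht : Tendsto (fun x => (x, F x)) (𝓝 0) (𝓝 (0 : ℝ × ℝ)) := by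
    have := (continuousAt_id.prodMk hF.continuousAt).tendsto
    simpa [hF0, Prod.zero_eq_mk] using this
  have h1 := (hX.comp_tendsto ht).trans (hq.norm_left.pow N)
  refine (h1.neg_left).congr' ?_ (EventuallyEq.refl _ _)
  filter_upwards [h] with x hx
  simp only [Function.comp_apply]
  linarith

theorem norm_polar_le {n : ℕ} (hn : 1 ≤ n) (φ : ℝ) {r : ℝ} (hr : 0 ≤ r) (hr1 : r ≤ 1) :
    ‖(r * Real.cos φ, -(r ^ n * Real.sin φ))‖ ≤ r := by
  rw [Prod.norm_def]
  refine max_le ?_ ?_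
  · rw [Real.norm_eq_abs, abs_mul, abs_of_nonneg hr]
    exact mul_le_of_le_one_right hr (Real.abs_cos_le_one φ)
  · rw [Real.norm_eq_abs, abs_neg, abs_mul, abs_of_nonneg (pow_nonneg hr n)]
    refine (mul_le_of_le_one_right (pow_nonneg hr n) (Real.abs_sin_le_one φ)).trans ?_
    exact pow_le_of_le_one hr hr1 (by omega)

/-- A Liénard system with higher order terms is a perturbation of its polynomial model. -/
theorem exists_isModelPerturbation {n p M : ℕ} (hn : 1 ≤ n)
    (hM₁ : n + p ≤ M + 1) (hM₂ : 2 * n - 1 + p ≤ M + 1) {a b : ℕ → ℝ} {gm fm : ℝ → ℝ}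
    (hgm : ∀ x, gm x = ∑ j ∈ Finset.Icc (2 * n - 1) M, a j * x ^ j)
    (hfm : ∀ x, fm x = ∑ j ∈ Finset.Icc (n - 1) (M - 1), b j * x ^ j)
    {X Y : ℝ → ℝ → ℝ} (hXa : AnalyticAt ℝ (fun q : ℝ × ℝ => X q.1 q.2) 0)
    (hYa : AnalyticAt ℝ (fun q : ℝ × ℝ => Y q.1 q.2) 0)
    (hX : (fun q : ℝ × ℝ => X q.1 q.2) =O[𝓝 (0 : ℝ × ℝ)] fun q => ‖q‖ ^ (M + 1))
    (hY : (fun q : ℝ × ℝ => Y q.1 q.2) =O[𝓝 (0 : ℝ × ℝ)] fun q => ‖q‖ ^ (M + 1))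
    {F : ℝ → ℝ} (hFa : AnalyticAt ℝ F 0) (hF0 : F 0 = 0)
    (hF : ∀ᶠ x in 𝓝 (0 : ℝ), F x + X x (F x) = 0) :
    ∃ W C ρ, IsModelPerturbation n p (lienardModel n M a b) (fun x y => y + X x y)
      (fun x y => -(gm x) - y * fm x + Y x y) F W C ρ := by
  obtain ⟨K, hK⟩ : ∃ K, ∀ᶠ x in 𝓝[>] (0 : ℝ), |F x| ≤ K * x ^ (n + p) := by
    obtain ⟨K, hK0, hK⟩ := (isBigO_of_add_eq_zero hFa.differentiableAt hF0 hX hF).exists_nonneg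
    refine ⟨K, ?_⟩
    filter_upwards [hK.bound.filter_mono nhdsWithin_le_nhds, self_mem_nhdsWithin,
      Ioo_mem_nhdsGT one_pos] with x h1 h2 h3
    have hx : 0 < x := h2
    rw [Real.norm_eq_abs, Real.norm_eq_abs, abs_of_pos (pow_pos hx _)] at h1
    exact h1.trans (mul_le_mul_of_nonneg_left (pow_le_pow_of_le_one hx.le h3.2.le hM₁) hK0)
  obtain ⟨W, C₀, hC₀, ρ₀, hρ₀, hW, hWL⟩ := hFa.exists_section_factor hK
  obtain ⟨C₁, hC₁, hX'⟩ := hX.exists_nonneg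
  obtain ⟨C₂, hC₂, hY'⟩ := hY.exists_nonneg
  obtain ⟨ρ₁, hρ₁, hball⟩ := Metric.eventually_nhds_iff_ball.1
    ((hX'.bound.and hY'.bound).and (hXa.eventually_analyticAt.and hYa.eventually_analyticAt))
  have hρle : min 1 (min ρ₀ ρ₁) ≤ 1 := min_le_left _ _
  have hρ₀le : min 1 (min ρ₀ ρ₁) ≤ ρ₀ := (min_le_right _ _).trans (min_le_left _ _)
  have hρ₁le : min 1 (min ρ₀ ρ₁) ≤ ρ₁ := (min_le_right _ _).trans (min_le_right _ _)
  have hρpos : 0 < min 1 (min ρ₀ ρ₁) := lt_min one_pos (lt_min hρ₀ hρ₁)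
  generalize min 1 (min ρ₀ ρ₁) = ρ at hρle hρ₀le hρ₁le hρpos
  have hg : ContDiff ℝ 1 gm := by
    rw [funext hgm]
    fun_prop
  have hf : ContDiff ℝ 1 fm := by
    rw [funext hfm]
    fun_prop
  have hmem : ∀ q : ℝ × ℝ, ‖q‖ < ρ → q ∈ ball (0 : ℝ × ℝ) ρ₁ := fun q hq => by
    rw [mem_ball_zero_iff]
    exact hq.trans_le hρ₁le
  have hpol : ∀ φ r, 0 < r → r < ρ → (r * Real.cos φ, -(r ^ n * Real.sin φ)) ∈ ball (0 : ℝ × ℝ) ρ₁ :=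
    fun φ r hr hrρ => hmem _ ((norm_polar_le hn φ hr.le (hrρ.le.trans hρle)).trans_lt hrρ)
  have hbound : ∀ {Z C' φ r : ℝ} {l : ℕ}, 0 ≤ C' → C' ≤ C₀ + C₁ + C₂ → 0 < r → r < ρ →
      l + p ≤ M + 1 → ‖Z‖ ≤ C' * ‖‖(r * Real.cos φ, -(r ^ n * Real.sin φ))‖ ^ (M + 1)‖ →
      |Z| ≤ (C₀ + C₁ + C₂) * r ^ l * r ^ p := by
    intro Z C' φ r l hC' hC'' hr hrρ hl hZ
    have hr1 := hrρ.le.trans hρle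
    rw [norm_pow, norm_norm, Real.norm_eq_abs] at hZ
    rw [mul_assoc, ← pow_add]
    refine hZ.trans (mul_le_mul hC'' ?_ (by positivity) (by positivity))
    exact (pow_le_pow_left₀ (norm_nonneg _) (norm_polar_le hn φ hr.le hr1) _).trans
      (pow_le_pow_of_le_one hr.le hr1 hl)
  refine ⟨W, C₀ + C₁ + C₂, ρ, ?_⟩
  constructor
  · positivity
  · exact hρpos
  · exact hρle
  · intro q hq
    exact contDiffAt_snd.add (hball q (hmem q hq)).2.1.contDiffAt
  · intro q hq
    exact ((hg.comp contDiff_fst).contDiffAt.neg.sub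
      (contDiffAt_snd.mul (hf.comp contDiff_fst).contDiffAt)).add
      (hball q (hmem q hq)).2.2.contDiffAt
  · intro φ r hr hrρ
    have h1 := (hball _ (hpol φ r hr hrρ)).1.1
    have e : ∀ Z, -(r ^ n * Real.sin φ) + Z + r ^ n * Real.sin φ = Z := fun Z => by ring
    rw [e]
    exact hbound hC₁ (by linarith) hr hrρ hM₁ h1
  · intro φ r hr hrρ
    have h1 := (hball _ (hpol φ r hr hrρ)).1.2
    have hr' : r ^ (n - 1) * r ^ n = r ^ (2 * n - 1) := by
      rw [← pow_add]
      congr 1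
      omega
    have e := lienard_eq_lienardModel (M := M) hn a b φ r
    rw [← hgm, ← hfm] at e
    rw [e, neg_add_eq_sub, sub_add_cancel, hr']
    exact hbound hC₂ (by linarith) hr hrρ hM₂ h1
  · exact fun x hx hxρ => (hW x ⟨hx, hxρ.trans_le hρ₀le⟩).1
  · intro x hx hxρ
    refine (hW x ⟨hx, hxρ.trans_le hρ₀le⟩).2.trans ?_
    exact mul_le_mul_of_nonneg_right (by linarith) (pow_pos hx p).le
  · intro x hx y hy
    refine (hWL x ⟨hx.1, hx.2.trans_le hρ₀le⟩ y ⟨hy.1, hy.2.trans_le hρ₀le⟩).trans ?_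
    exact mul_le_mul_of_nonneg_right (by linarith) (abs_nonneg _)

/-- **Theorem 1.10.**  Let (1.22) be the order-`M` normal form
`x' = y + X_{M+1}`, `y' = -g_M(x,δ) - y f_{M-1}(x,δ) + Y_{M+1}` and (1.24) its
polynomial truncation `x' = y`, `y' = -g_M(x,δ) - y f_{M-1}(x,δ)`.  If
`M ≥ (k+2)n - 2` then the coefficients `v_j(δ)` and `v̄_j(δ)` of the expansions of
the respective Poincaré return maps agree for `1 ≤ j ≤ kn`. -/
theorem truncation_preserves_return_map_coefficients
    (n mp M k : ℕ) (hn : 2 ≤ n) (hk : 1 ≤ k)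
    (hM : 2 * n - 1 < M) (hMk : (k + 2) * n - 2 ≤ M)
    (D : Set (Fin mp → ℝ)) (hD : IsCompact D)
    -- the coefficients of `g_M` and `f_{M-1}`
    (a b : ℕ → (Fin mp → ℝ) → ℝ)
    (ha : ∀ δ ∈ D, 0 < a (2 * n - 1) δ)
    (hab : ∀ δ ∈ D, (b (n - 1) δ) ^ 2 - 4 * n * a (2 * n - 1) δ < 0)
    (gm fm : ℝ → (Fin mp → ℝ) → ℝ)
    (hgm : ∀ x δ, gm x δ = ∑ j ∈ Finset.Icc (2 * n - 1) M, a j δ * x ^ j)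
    (hfm : ∀ x δ, fm x δ = ∑ j ∈ Finset.Icc (n - 1) (M - 1), b j δ * x ^ j)
    -- the higher order terms `X_{M+1}`, `Y_{M+1}`
    (XM YM : ℝ → ℝ → (Fin mp → ℝ) → ℝ)
    (hXMana : ∀ δ ∈ D, AnalyticAt ℝ
      (fun p : ℝ × ℝ × (Fin mp → ℝ) => XM p.1 p.2.1 p.2.2) (0, 0, δ))
    (hYMana : ∀ δ ∈ D, AnalyticAt ℝ
      (fun p : ℝ × ℝ × (Fin mp → ℝ) => YM p.1 p.2.1 p.2.2) (0, 0, δ))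
    (hXMsmall : ∀ δ ∈ D,
      (fun p : ℝ × ℝ => XM p.1 p.2 δ) =O[nhds (0 : ℝ × ℝ)] fun p => ‖p‖ ^ (M + 1))
    (hYMsmall : ∀ δ ∈ D,
      (fun p : ℝ × ℝ => YM p.1 p.2 δ) =O[nhds (0 : ℝ × ℝ)] fun p => ‖p‖ ^ (M + 1))
    -- `y = F(x,δ)` solves `y + X_{M+1}(x,y,δ) = 0` (the section for (1.22))
    (F : ℝ → (Fin mp → ℝ) → ℝ)
    (hFana : ∀ δ ∈ D, AnalyticAt ℝ (fun x => F x δ) 0)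
    (hF0 : ∀ δ ∈ D, F 0 δ = 0)
    (hFsol : ∀ δ ∈ D, ∀ᶠ x in nhds (0 : ℝ), F x δ + XM x (F x δ) δ = 0)
    -- the Poincaré return maps `P` of (1.22) and `P_M` of (1.24)
    (P Pm : ℝ → (Fin mp → ℝ) → ℝ)
    (hP : ∀ δ ∈ D, IsReturnMap
      (fun x y => y + XM x y δ)
      (fun x y => -(gm x δ) - y * fm x δ + YM x y δ)
      (fun x => F x δ) (fun x₀ => P x₀ δ))
    (hPm : ∀ δ ∈ D, IsReturnMap
      (fun _ y => y)
      (fun x y => -(gm x δ) - y * fm x δ)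
      (fun _ => 0) (fun x₀ => Pm x₀ δ))
    -- the analytic extensions of the return maps provided by Theorem 1.4
    (Pb Pbm : ℝ → (Fin mp → ℝ) → ℝ)
    (hPb : ∀ δ ∈ D, AnalyticAt ℝ (fun x₀ => Pb x₀ δ) 0 ∧ Pb 0 δ = 0 ∧
      0 < deriv (fun x₀ => Pb x₀ δ) 0 ∧
      ∀ᶠ x₀ in nhdsWithin (0 : ℝ) (Ioi 0), P x₀ δ = Pb x₀ δ)
    (hPbm : ∀ δ ∈ D, AnalyticAt ℝ (fun x₀ => Pbm x₀ δ) 0 ∧ Pbm 0 δ = 0 ∧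
      0 < deriv (fun x₀ => Pbm x₀ δ) 0 ∧
      ∀ᶠ x₀ in nhdsWithin (0 : ℝ) (Ioi 0), Pm x₀ δ = Pbm x₀ δ)
    -- the expansion coefficients (1.23) and (1.25)
    (v vbar : ℕ → (Fin mp → ℝ) → ℝ)
    (hv : ∀ δ ∈ D, ∀ j : ℕ,
      iteratedDeriv j (fun x₀ => Pb x₀ δ - x₀) 0 = (j.factorial : ℝ) * v j δ)
    (hvbar : ∀ δ ∈ D, ∀ j : ℕ,
      iteratedDeriv j (fun x₀ => Pbm x₀ δ - x₀) 0 = (j.factorial : ℝ) * vbar j δ) :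
    ∀ δ ∈ D, ∀ j : ℕ, 1 ≤ j → j ≤ k * n → v j δ = vbar j δ := by
  intro δ hδ j _ hj
  have hn1 : 1 ≤ n := by omega
  have hkn : n ≤ k * n := Nat.le_mul_of_pos_left n hk
  have hk2 : (k + 2) * n = k * n + 2 * n := by ring
  obtain ⟨κ, A, L, ρ₀, hA, hρ₀, hG⟩ := exists_modelBounds
    (contDiff_lienardModel n M (fun i => a i δ) fun i => b i δ)
    (lienardModel_denom_pos hn1 hM (ha δ hδ) (hab δ hδ))
  have hslice : ∀ Z : ℝ → ℝ → (Fin mp → ℝ) → ℝ,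
      AnalyticAt ℝ (fun p : ℝ × ℝ × (Fin mp → ℝ) => Z p.1 p.2.1 p.2.2) (0, 0, δ) →
      AnalyticAt ℝ (fun q : ℝ × ℝ => Z q.1 q.2 δ) 0 := fun Z hZ =>
    hZ.comp_of_eq (f := fun q : ℝ × ℝ => (q.1, q.2, δ))
      (analyticAt_fst.prod (analyticAt_snd.prod analyticAt_const)) rfl
  obtain ⟨W, C, ρ, hfull⟩ := exists_isModelPerturbation (p := k * n) hn1 (by omega) (by omega)
    (fun x => hgm x δ) (fun x => hfm x δ) (X := fun x y => XM x y δ) (Y := fun x y => YM x y δ)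
    (hslice XM (hXMana δ hδ)) (hslice YM (hYMana δ hδ)) (hXMsmall δ hδ) (hYMsmall δ hδ)
    (hFana δ hδ) (hF0 δ hδ) (hFsol δ hδ)
  obtain ⟨W', C', ρ', htrunc⟩ := exists_isModelPerturbation (p := k * n) (M := M) hn1 (by omega)
    (by omega) (fun x => hgm x δ) (fun x => hfm x δ) (X := fun _ _ => 0) (Y := fun _ _ => 0)
    (F := fun _ => 0) analyticAt_const analyticAt_const (Asymptotics.isBigO_zero _ _)
    (Asymptotics.isBigO_zero _ _) analyticAt_const rfl (Eventually.of_forall fun _ => add_zero 0)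
  simp only [add_zero] at htrunc
  obtain ⟨K, hK⟩ := IsReturnMap.eventually_abs_sub_le hn1 (by omega) hG hA hρ₀ hfull htrunc
    (hP δ hδ) (hPm δ hδ)
  obtain ⟨hPa, -, -, hPe⟩ := hPb δ hδ
  obtain ⟨hQa, -, -, hQe⟩ := hPbm δ hδ
  have hzero := (hPa.sub hQa).iteratedDeriv_eq_zero_of_abs_le (N := k * n) (C := K) (by
    filter_upwards [hK, hPe, hQe] with x h1 h2 h3
    rw [Pi.sub_apply, ← h2, ← h3]
    exact h1) hj
  have hsum : (fun x => Pb x δ - x) =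
      (fun x => Pbm x δ - x) + ((fun x => Pb x δ) - fun x => Pbm x δ) := by
    ext x
    simp
  have hd := hv δ hδ j
  have hid : AnalyticAt ℝ (fun x => Pbm x δ - x) 0 := hQa.sub analyticAt_id
  rw [hsum, iteratedDeriv_add hid.contDiffAt (hPa.sub hQa).contDiffAt, hzero,
    add_zero, hvbar δ hδ j] at hd
  exact (mul_left_cancel₀ (Nat.cast_ne_zero.2 j.factorial_ne_zero) hd).symm
end

section
/- Under the generalized polar coordinates x = r·cos θ, y = rⁿ·sin θ (r > 0), the system (2.1) becomes θ' = S(θ,r), r' = R(θ,r), where S(θ,r) = [cos θ·Ẏ − n·r^{n-1}·sin θ·Ẋ]/(rⁿ·H(θ)) and R(θ,r) = [sin θ·Ẏ + r^{n-1}·cos θ·Ẋ]/(r^{n-1}·H(θ)), with H(θ) = cos²θ + n·sin²θ > 0 and Ẋ, Ẏ the right-hand sides of (2.1) evaluated at (r cos θ, rⁿ sin θ). The functions S and R are 2π-periodic in θ and satisfy the symmetries S(π + (−1)^{n-1}θ, −r) = (−1)^{n-1}·S(θ,r) and R(π + (−1)^{n-1}θ, −r) = −R(θ,r). Moreover S(θ,r)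 = (r^{n-1}/H(θ))·[S₀(θ) + O(r)] and R(θ,r) = (rⁿ/H(θ))·[R₀(θ) + O(r)], where S₀(θ) = −[n sin²θ + b_{n-1} cosⁿθ sin θ + a_{2n-1} cos^{2n}θ] < 0 for all θ, and R₀(θ) = cos θ sin θ·(1 − a_{2n-1} cos^{2n-2}θ − b_{n-1} sin θ cos^{n-2}θ). -/
open Real Set Filter

/-- A function analytic at `0` deviates from its value there at most linearly. -/
lemma AnalyticAt.exists_abs_sub_le {u : ℝ → ℝ} (hu : AnalyticAt ℝ u 0) :
    ∃ C ≥ 0, ∀ᶠ x in nhds (0 : ℝ), |u x - u 0| ≤ C * |x| := by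
  obtain ⟨C, hC, h⟩ := hu.differentiableAt.isBigO_sub.exists_nonneg
  exact ⟨C, hC, by simpa using h.bound⟩

lemma abs_mul_le_of_abs_le_one {t x B : ℝ} (ht : |t| ≤ 1) (hx : |x| ≤ B) : |t * x| ≤ B := by
  rw [abs_mul]
  exact (mul_le_of_le_one_left (abs_nonneg x) ht).trans hx

/-- Generalized polar coordinates are bounded by the radius when the radius is at most one. -/
lemma norm_generalized_polar_le {n : ℕ} (hn : n ≠ 0) (θ : ℝ) {r : ℝ} (hr : |r| ≤ 1) :
    ‖(r * cos θ, r ^ n * sin θ)‖ ≤ |r| := by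
  refine norm_prod_le_iff.2 ⟨?_, ?_⟩
  · simpa [abs_mul] using mul_le_of_le_one_right (abs_nonneg r) (abs_cos_le_one θ)
  · have h : |r| ^ n ≤ |r| := pow_le_of_le_one (abs_nonneg r) hr hn
    simpa [abs_mul] using
      (mul_le_of_le_one_right (pow_nonneg (abs_nonneg r) n) (abs_sin_le_one θ)).trans h

/-- **Lemma 2.1.**  Under the generalized polar coordinates `x = r cos θ`,
`y = rⁿ sin θ` (`r > 0`), system (2.1) becomes `θ' = S(θ,r)`, `r' = R(θ,r)` with
`S, R` given by the stated formulas; `S` and `R` are `2π`-periodic in `θ`, satisfy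
the symmetries `S(π+(-1)^{n-1}θ,-r) = (-1)^{n-1}S(θ,r)`,
`R(π+(-1)^{n-1}θ,-r) = -R(θ,r)`, and have the expansions
`S = (r^{n-1}/H)(S₀ + O(r))`, `R = (rⁿ/H)(R₀ + O(r))` with `S₀ < 0` everywhere. -/
theorem generalized_polar_coordinates
    (n : ℕ) (hn : 2 ≤ n)
    (Z₁ Z₂ : ℝ → ℝ → ℝ)
    (hZ₁ana : AnalyticAt ℝ (fun p : ℝ × ℝ => Z₁ p.1 p.2) (0, 0))
    (hZ₂ana : AnalyticAt ℝ (fun p : ℝ × ℝ => Z₂ p.1 p.2) (0, 0))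
    (hZ₁small : (fun p : ℝ × ℝ => Z₁ p.1 p.2) =O[nhds (0 : ℝ × ℝ)] fun p => ‖p‖)
    (g f : ℝ → ℝ) (a b : ℝ)
    (ha : 0 < a)
    (hg : ∃ u : ℝ → ℝ, AnalyticAt ℝ u 0 ∧ u 0 = a ∧
      ∀ᶠ x in nhds (0 : ℝ), g x = x ^ (2 * n - 1) * u x)
    (hf : ∃ w : ℝ → ℝ, AnalyticAt ℝ w 0 ∧ w 0 = b ∧
      ∀ᶠ x in nhds (0 : ℝ), f x = x ^ (n - 1) * w x)
    (hb : b ^ 2 - 4 * n * a < 0)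
    -- `H`, the right-hand sides of (2.1) in the new coordinates, `S`, `R`,
    -- and the leading terms `S₀`, `R₀`:
    (H : ℝ → ℝ) (hH : ∀ θ, H θ = cos θ ^ 2 + n * sin θ ^ 2)
    (Xd Yd : ℝ → ℝ → ℝ)
    (hXd : ∀ θ r, Xd θ r =
      r ^ n * sin θ * (1 + Z₁ (r * cos θ) (r ^ n * sin θ)))
    (hYd : ∀ θ r, Yd θ r =
      -g (r * cos θ) - r ^ n * sin θ * f (r * cos θ) +
        (r ^ n * sin θ) ^ 2 * Z₂ (r * cos θ) (r ^ n * sin θ))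
    (S R : ℝ → ℝ → ℝ)
    (hS : ∀ θ r, S θ r =
      (cos θ * Yd θ r - n * r ^ (n - 1) * sin θ * Xd θ r) / (r ^ n * H θ))
    (hR : ∀ θ r, R θ r =
      (sin θ * Yd θ r + r ^ (n - 1) * cos θ * Xd θ r) / (r ^ (n - 1) * H θ))
    (S₀ R₀ : ℝ → ℝ)
    (hS₀ : ∀ θ, S₀ θ = -(n * sin θ ^ 2 + b * cos θ ^ n * sin θ + a * cos θ ^ (2 * n)))
    (hR₀ : ∀ θ, R₀ θ = cos θ * sin θ *
      (1 - a * cos θ ^ (2 * n - 2) - b * sin θ * cos θ ^ (n - 2))) :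
    -- H is positive
    (∀ θ : ℝ, 0 < H θ) ∧
    -- the change of coordinates transforms (2.1) into θ' = S, r' = R
    (∀ (Θ ρ : ℝ → ℝ) (dΘ dρ t : ℝ), 0 < ρ t →
      HasDerivAt Θ dΘ t → HasDerivAt ρ dρ t →
      HasDerivAt (fun s => ρ s * cos (Θ s)) (Xd (Θ t) (ρ t)) t →
      HasDerivAt (fun s => ρ s ^ n * sin (Θ s)) (Yd (Θ t) (ρ t)) t →
      dΘ = S (Θ t) (ρ t) ∧ dρ = R (Θ t) (ρ t)) ∧
    -- 2π-periodicity in θ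
    (∀ θ r : ℝ, S (θ + 2 * π) r = S θ r ∧ R (θ + 2 * π) r = R θ r) ∧
    -- the symmetries (2.4)
    (∀ θ r : ℝ,
      S (π + (-1 : ℝ) ^ (n - 1) * θ) (-r) = (-1 : ℝ) ^ (n - 1) * S θ r ∧
      R (π + (-1 : ℝ) ^ (n - 1) * θ) (-r) = -R θ r) ∧
    -- the expansions S = (r^{n-1}/H)(S₀ + O(r)), R = (rⁿ/H)(R₀ + O(r))
    (∃ C ε : ℝ, 0 < ε ∧ 0 < C ∧ ∀ θ r : ℝ, r ≠ 0 → |r| < ε →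
      |S θ r * H θ / r ^ (n - 1) - S₀ θ| ≤ C * |r| ∧
      |R θ r * H θ / r ^ n - R₀ θ| ≤ C * |r|) ∧
    -- S₀ is everywhere negative
    (∀ θ : ℝ, S₀ θ < 0) := by
  obtain ⟨m, rfl⟩ : ∃ m, n = m + 2 := ⟨n - 2, by omega⟩
  have e₁ : m + 2 - 1 = m + 1 := by omega
  have e₂ : 2 * (m + 2) - 1 = 2 * m + 3 := by omega
  have e₃ : 2 * (m + 2) - 2 = 2 * m + 2 := by omega
  have e₄ : m + 2 - 2 = m := by omega
  rw [e₂] at hg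
  rw [e₁] at hf
  simp only [e₁] at hS hR ⊢
  simp only [e₃, e₄] at hR₀
  have hN : (0 : ℝ) < ((m + 2 : ℕ) : ℝ) := by positivity
  have hpos : ∀ θ, 0 < H θ := by
    intro θ
    rw [hH]
    have h1 : (1 : ℝ) ≤ ((m + 2 : ℕ) : ℝ) := by exact_mod_cast (by omega : 1 ≤ m + 2)
    nlinarith [sin_sq_add_cos_sq θ, mul_nonneg (sub_nonneg.2 h1) (sq_nonneg (sin θ))]
  refine ⟨hpos, ?_, ?_, ?_, ?_, ?_⟩
  · intro Θ ρ dΘ dρ t hρ hΘ hρ' hX hY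
    have hX' := hX.unique (hρ'.mul hΘ.cos)
    have hY' := hY.unique ((hρ'.pow (m + 2)).mul hΘ.sin)
    have hHne := (hpos (Θ t)).ne'
    simp only [Pi.pow_apply, e₁] at hY'
    constructor
    · rw [hS, eq_div_iff (by positivity), hX', hY', hH]
      ring
    · rw [hR, eq_div_iff (by positivity), hX', hY', hH]
      ring
  · intro θ r
    simp only [hS, hR, hXd, hYd, hH, cos_add_two_pi, sin_add_two_pi, and_self]
  · intro θ r
    rcases Nat.even_or_odd m with hm | hm
    · have h₁ : (-1 : ℝ) ^ (m + 1) = -1 := hm.add_one.neg_one_pow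
      have h₂ : (-r) ^ (m + 1) = -r ^ (m + 1) := hm.add_one.neg_pow r
      have h₃ : (-r) ^ (m + 2) = r ^ (m + 2) := (hm.add even_two).neg_pow r
      have hc : cos (π + -1 * θ) = -cos θ := by rw [neg_one_mul, ← sub_eq_add_neg, cos_pi_sub]
      have hs : sin (π + -1 * θ) = sin θ := by rw [neg_one_mul, ← sub_eq_add_neg, sin_pi_sub]
      simp only [hS, hR, hXd, hYd, hH, h₁, h₂, h₃, hc, hs, neg_mul_neg]
      constructor
      · ring
      · rw [neg_sq, neg_mul (r ^ (m + 1)) (_ + _), div_neg]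
    · have h₁ : (-1 : ℝ) ^ (m + 1) = 1 := hm.add_one.neg_one_pow
      have h₂ : (-r) ^ (m + 1) = r ^ (m + 1) := hm.add_one.neg_pow r
      have h₃ : (-r) ^ (m + 2) = -r ^ (m + 2) := (hm.add_even even_two).neg_pow r
      have hc : cos (π + 1 * θ) = -cos θ := by rw [one_mul, add_comm, cos_add_pi]
      have hs : sin (π + 1 * θ) = -sin θ := by rw [one_mul, add_comm, sin_add_pi]
      simp only [hS, hR, hXd, hYd, hH, h₁, h₂, h₃, hc, hs, neg_mul_neg, neg_sq]
      constructor
      · rw [neg_mul (r ^ (m + 2)) (_ + _), div_neg]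
        ring
      · ring
  · obtain ⟨u, hu, rfl, hgu⟩ := hg
    obtain ⟨w, hw, rfl, hfw⟩ := hf
    obtain ⟨A, hA, hAu⟩ := hu.exists_abs_sub_le
    obtain ⟨B, hB, hBw⟩ := hw.exists_abs_sub_le
    obtain ⟨D, hD, hDZ⟩ := hZ₁small.exists_nonneg
    obtain ⟨E, hE, hEZ⟩ := (hZ₂ana.continuousAt.isBigO_one ℝ).exists_nonneg
    obtain ⟨δ, hδ, hball⟩ := Metric.eventually_nhds_iff.1
      (hgu.and (hfw.and (hAu.and hBw)))
    obtain ⟨η, hη, hball'⟩ := Metric.eventually_nhds_iff.1 (hDZ.bound.and hEZ.bound)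
    refine ⟨A + B + E + (m + 2 : ℕ) * D + 1, min 1 (min δ η), by positivity, by positivity, ?_⟩
    intro θ r hr hrε
    obtain ⟨hr1, hrδ, hrη⟩ : |r| < 1 ∧ |r| < δ ∧ |r| < η := by simpa using hrε
    have hc := abs_cos_le_one θ
    have hs := abs_sin_le_one θ
    have hx : |r * cos θ| ≤ |r| := by
      simpa [abs_mul] using mul_le_of_le_one_right (abs_nonneg r) hc
    have hp := norm_generalized_polar_le (n := m + 2) (by omega) θ hr1.le
    obtain ⟨hg', hf', hA', hB'⟩ := hball (y := r * cos θ) (by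
      simpa only [dist_zero_right, norm_eq_abs] using hx.trans_lt hrδ)
    obtain ⟨hD', hE'⟩ := hball' (y := (r * cos θ, r ^ (m + 2) * sin θ)) (by
      simpa only [Prod.mk_zero_zero, dist_zero_right] using hp.trans_lt hrη)
    simp only [norm_eq_abs, norm_one, mul_one, abs_norm] at hD' hE'
    replace hA' := hA'.trans (mul_le_mul_of_nonneg_left hx hA)
    replace hB' := hB'.trans (mul_le_mul_of_nonneg_left hx hB)
    replace hD' := hD'.trans (mul_le_mul_of_nonneg_left hp hD)
    have hHne := (hpos θ).ne'
    have hYd' := hYd θ r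
    have hXd' := hXd θ r
    rw [hg', hf'] at hYd'
    generalize Z₁ (r * cos θ) (r ^ (m + 2) * sin θ) = z₁ at *
    generalize Z₂ (r * cos θ) (r ^ (m + 2) * sin θ) = z₂ at *
    generalize u (r * cos θ) = u' at *
    generalize w (r * cos θ) = w' at *
    have hE'' : |r * z₂| ≤ E * |r| := by
      rw [abs_mul, mul_comm]
      exact mul_le_mul_of_nonneg_right hE' (abs_nonneg r)
    have hcp (k : ℕ) : |cos θ ^ k| ≤ 1 := by
      rw [abs_pow]
      exact pow_le_one₀ (abs_nonneg _) hc
    have hsp (k : ℕ) : |sin θ ^ k| ≤ 1 := by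
      rw [abs_pow]
      exact pow_le_one₀ (abs_nonneg _) hs
    have hcs (k l : ℕ) : |cos θ ^ k * sin θ ^ l| ≤ 1 :=
      abs_mul_le_of_abs_le_one (hcp k) (hsp l)
    have hr0 := abs_nonneg r
    constructor
    · have key : S θ r * H θ / r ^ (m + 1) - S₀ θ =
          -((cos θ ^ (2 * m + 4) * sin θ ^ 0) * (u' - u 0))
            - (cos θ ^ (m + 2) * sin θ ^ 1) * (w' - w 0)
            + (cos θ ^ 1 * sin θ ^ 2) * (r * z₂)
            - (m + 2 : ℕ) * ((cos θ ^ 0 * sin θ ^ 2) * z₁) := by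
        rw [hS, hS₀, hXd', hYd']
        field_simp
        ring
      have h₁ := abs_le.1 (abs_mul_le_of_abs_le_one (hcs (2 * m + 4) 0) hA')
      have h₂ := abs_le.1 (abs_mul_le_of_abs_le_one (hcs (m + 2) 1) hB')
      have h₃ := abs_le.1 (abs_mul_le_of_abs_le_one (hcs 1 2) hE'')
      have h₄ := abs_le.1 (abs_mul_le_of_abs_le_one (hcs 0 2) hD')
      have h₅ := mul_le_mul_of_nonneg_left h₄.1 hN.le
      have h₆ := mul_le_mul_of_nonneg_left h₄.2 hN.le
      rw [key, abs_le]
      constructor <;> linarith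
    · have key : R θ r * H θ / r ^ (m + 2) - R₀ θ =
          -((cos θ ^ (2 * m + 3) * sin θ ^ 1) * (u' - u 0))
            - (cos θ ^ (m + 1) * sin θ ^ 2) * (w' - w 0)
            + (cos θ ^ 0 * sin θ ^ 3) * (r * z₂)
            + (cos θ ^ 1 * sin θ ^ 1) * z₁ := by
        rw [hR, hR₀, hXd', hYd']
        field_simp
        ring
      have h₁ := abs_le.1 (abs_mul_le_of_abs_le_one (hcs (2 * m + 3) 1) hA')
      have h₂ := abs_le.1 (abs_mul_le_of_abs_le_one (hcs (m + 1) 2) hB')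
      have h₃ := abs_le.1 (abs_mul_le_of_abs_le_one (hcs 0 3) hE'')
      have h₄ := abs_le.1 (abs_mul_le_of_abs_le_one (hcs 1 1) hD')
      have hD1 : D * |r| ≤ (m + 2 : ℕ) * D * |r| := by
        rw [mul_assoc]
        refine le_mul_of_one_le_left (by positivity) ?_
        exact_mod_cast (by omega : 1 ≤ m + 2)
      rw [key, abs_le]
      constructor <;> linarith
  · intro θ
    rw [hS₀, neg_lt_zero, pow_mul', sq (cos θ ^ (m + 2))]
    generalize hC : cos θ ^ (m + 2) = c
    by_cases h0 : c = 0
    · have hcos : cos θ = 0 := eq_zero_of_pow_eq_zero (hC.trans h0)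
      have hsq : sin θ ^ 2 = 1 := by simpa [hcos] using sin_sq_add_cos_sq θ
      rw [h0, hsq]
      simpa using hN
    · have hc2 : 0 < c ^ 2 := by positivity
      have h1 : 0 < 4 * ((m + 2 : ℕ) : ℝ) *
          ((m + 2 : ℕ) * sin θ ^ 2 + b * c * sin θ + a * (c * c)) := by
        nlinarith [sq_nonneg (2 * ((m + 2 : ℕ) : ℝ) * sin θ + b * c),
          mul_pos (neg_pos.2 hb) hc2]
      exact pos_of_mul_pos_right h1 (by positivity)
end

section
/- For |h| sufficiently small, the solution r(θ,h) of dr/dθ = R̄(θ,r) with r(0,h) = h satisfies the symmetry identity r(θ, −r(π,h)) = −r(π + (−1)^{n-1}θ, h) for all θ for which both sides are defined. -/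
open Real Set

/-- Two solutions of a scalar ODE with `C¹` right-hand side on the strip `|r| < ε`, both staying in
that strip over a compact interval, coincide there as soon as they agree at one interior point. -/
theorem eqOn_Icc_of_hasDerivAt_of_contDiffAt {ε : ℝ} {F : ℝ × ℝ → ℝ}
    (hF : ∀ θ r : ℝ, |r| < ε → ContDiffAt ℝ 1 F (θ, r))
    {a b t₀ : ℝ} (ht₀ : t₀ ∈ Ioo a b) {f g : ℝ → ℝ}
    (hfε : ∀ t ∈ Icc a b, |f t| < ε) (hgε : ∀ t ∈ Icc a b, |g t| < ε)
    (hf : ∀ t ∈ Icc a b, HasDerivAt f (F (t, f t)) t)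
    (hg : ∀ t ∈ Icc a b, HasDerivAt g (F (t, g t)) t)
    (h₀ : f t₀ = g t₀) : EqOn f g (Icc a b) := by
  have hfc : ContinuousOn f (Icc a b) := fun t ht => (hf t ht).continuousAt.continuousWithinAt
  have hgc : ContinuousOn g (Icc a b) := fun t ht => (hg t ht).continuousAt.continuousWithinAt
  obtain ⟨c, hcε, hfb, hgb⟩ : ∃ c < ε, (∀ t ∈ Icc a b, |f t| ≤ c) ∧ ∀ t ∈ Icc a b, |g t| ≤ c := by
    have hne : (Icc a b).Nonempty := ⟨t₀, Ioo_subset_Icc_self ht₀⟩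
    obtain ⟨t, ht, hmax⟩ := isCompact_Icc.exists_isMaxOn hne (hfc.abs.sup hgc.abs)
    exact ⟨|f t| ⊔ |g t|, max_lt (hfε t ht) (hgε t ht),
      fun s hs => le_sup_left.trans (hmax hs), fun s hs => le_sup_right.trans (hmax hs)⟩
  have hstrip : ∀ r ∈ Icc (-c) c, |r| < ε := fun r hr => (abs_le.2 hr).trans_lt hcε
  have hcont : ContinuousOn (fderiv ℝ F) (Icc a b ×ˢ Icc (-c) c) := fun p hp =>
    ((hF p.1 p.2 (hstrip _ hp.2)).continuousAt_fderiv one_ne_zero).continuousWithinAt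
  obtain ⟨C, hC⟩ := (isCompact_Icc.prod isCompact_Icc).exists_bound_of_continuousOn
    (hcont.clm_apply (continuousOn_const (c := ((0 : ℝ), (1 : ℝ)))))
  have hlip : ∀ t ∈ Ioo a b, LipschitzOnWith C.toNNReal (fun r => F (t, r)) (Icc (-c) c) := by
    intro t ht
    refine (convex_Icc (-c) c).lipschitzOnWith_of_nnnorm_hasDerivWithin_le
      (f' := fun r => fderiv ℝ F (t, r) (0, 1)) (fun r hr => ?_) fun r hr => ?_
    · have hd := ((hF t r (hstrip r hr)).differentiableAt one_ne_zero).hasFDerivAt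
      exact (hd.comp_hasDerivAt r
        ((hasDerivAt_const r t).prodMk (hasDerivAt_id r))).hasDerivWithinAt
    · exact NNReal.le_toNNReal_of_coe_le (hC (t, r) ⟨Ioo_subset_Icc_self ht, hr⟩)
  exact ODE_solution_unique_of_mem_Icc hlip ht₀
    hfc (fun t ht => hf t (Ioo_subset_Icc_self ht))
    (fun t ht => abs_le.1 (hfb t (Ioo_subset_Icc_self ht)))
    hgc (fun t ht => hg t (Ioo_subset_Icc_self ht))
    (fun t ht => abs_le.1 (hgb t (Ioo_subset_Icc_self ht))) h₀

/-- **Lemma 2.2(1).**  Let `R̄(θ,r)` be real-analytic on `ℝ × (-ε,ε)`, `2π`-periodic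
in `θ`, with `R̄(θ,0) = 0` and the symmetry `R̄(π + (-1)^{n-1}θ, -r) = (-1)ⁿ R̄(θ,r)`.
If `r(θ,h)` solves `dr/dθ = R̄(θ,r)`, `r(0,h) = h` on `[-2π,2π]` (depending
continuously on the initial value `h`), then for `|h|` sufficiently small
`r(θ, -r(π,h)) = -r(π + (-1)^{n-1}θ, h)`. -/
theorem solution_symmetry
    (n : ℕ) (hn : 2 ≤ n) (ε : ℝ) (hε : 0 < ε)
    (Rb : ℝ → ℝ → ℝ)
    (hRana : ∀ θ r : ℝ, |r| < ε → AnalyticAt ℝ (fun p : ℝ × ℝ => Rb p.1 p.2) (θ, r))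
    (hRper : ∀ θ r : ℝ, Rb (θ + 2 * π) r = Rb θ r)
    (hR0 : ∀ θ : ℝ, Rb θ 0 = 0)
    (hRsym : ∀ θ r : ℝ, |r| < ε →
      Rb (π + (-1 : ℝ) ^ (n - 1) * θ) (-r) = (-1 : ℝ) ^ n * Rb θ r)
    (sol : ℝ → ℝ → ℝ) (η : ℝ) (hη : 0 < η) (hηε : η ≤ ε)
    (hinit : ∀ h : ℝ, |h| < η → sol 0 h = h)
    (hsol : ∀ h : ℝ, |h| < η → ∀ θ ∈ Icc (-(2 * π)) (2 * π),
      |sol θ h| < ε ∧ HasDerivAt (fun s => sol s h) (Rb θ (sol θ h)) θ)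
    (hcont : ContinuousOn (fun p : ℝ × ℝ => sol p.1 p.2)
      (Icc (-(2 * π)) (2 * π) ×ˢ Metric.ball (0 : ℝ) η)) :
    ∃ η' > 0, ∀ h : ℝ, |h| < η' → ∀ θ ∈ Icc (-π) π,
      sol θ (-(sol π h)) = -(sol (π + (-1 : ℝ) ^ (n - 1) * θ) h) := by
  have hπ := Real.pi_pos
  have hF : ∀ θ r : ℝ, |r| < ε → ContDiffAt ℝ 1 (fun p : ℝ × ℝ => Rb p.1 p.2) (θ, r) :=
    fun θ r hr => (hRana θ r hr).contDiffAt
  have hzero : sol π 0 = 0 := by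
    have h0 : |(0 : ℝ)| < η := by simpa using hη
    exact eqOn_Icc_of_hasDerivAt_of_contDiffAt hF (a := -(2 * π)) (b := 2 * π) (t₀ := 0)
      (f := fun s => sol s 0) (g := fun _ => 0) ⟨by linarith, by linarith⟩
      (fun t ht => (hsol 0 h0 t ht).1) (fun t _ => by simpa using hε)
      (fun t ht => (hsol 0 h0 t ht).2)
      (fun t _ => by simpa [hR0] using hasDerivAt_const t (0 : ℝ))
      (hinit 0 h0) ⟨by linarith, by linarith⟩
  obtain ⟨δ, hδ, hδη⟩ : ∃ δ > 0, ∀ h : ℝ, |h| < δ → |h| < η ∧ |sol π h| < η := by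
    have hsec : ContinuousOn (fun h => sol π h) (Metric.ball (0 : ℝ) η) :=
      hcont.comp (f := fun h : ℝ => (π, h)) (by fun_prop)
        fun h hh => ⟨⟨by linarith, by linarith⟩, hh⟩
    have hball := Metric.ball_mem_nhds (0 : ℝ) hη
    have hmem := (hsec.continuousAt hball).preimage_mem_nhds
      (t := Metric.ball (0 : ℝ) η) (by simpa only [hzero] using hball)
    obtain ⟨δ, hδ, hsub⟩ := Metric.mem_nhds_iff.1 (Filter.inter_mem hball hmem)
    exact ⟨δ, hδ, fun h hh => by simpa using hsub (by simpa using hh : h ∈ Metric.ball (0 : ℝ) δ)⟩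
  refine ⟨δ, hδ, fun h hh => ?_⟩
  obtain ⟨hhη, hsη⟩ := hδη h hh
  rw [← abs_neg] at hsη
  have hpow : (-1 : ℝ) ^ n = -(-1 : ℝ) ^ (n - 1) := by
    obtain ⟨m, rfl⟩ : ∃ m, n = m + 1 := ⟨n - 1, by omega⟩
    simp [pow_succ]
  have hsq : (-1 : ℝ) ^ n * (-1 : ℝ) ^ n = 1 := by
    rw [← mul_pow]; norm_num
  have hrange : ∀ t ∈ Icc (-π) π, π + (-1 : ℝ) ^ (n - 1) * t ∈ Icc (-(2 * π)) (2 * π) := by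
    rintro t ⟨ht₁, ht₂⟩
    rcases neg_one_pow_eq_or ℝ (n - 1) with hs | hs <;> rw [hs] <;> constructor <;> linarith
  have hsub : Icc (-π) π ⊆ Icc (-(2 * π)) (2 * π) := Icc_subset_Icc (by linarith) (by linarith)
  refine eqOn_Icc_of_hasDerivAt_of_contDiffAt hF (t₀ := 0)
    (f := fun t => sol t (-(sol π h))) (g := fun t => -(sol (π + (-1 : ℝ) ^ (n - 1) * t) h))
    ⟨by linarith, hπ⟩ (fun t ht => (hsol _ hsη t (hsub ht)).1)
    (fun t ht => by simpa using (hsol h hhη _ (hrange t ht)).1)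
    (fun t ht => (hsol _ hsη t (hsub ht)).2) (fun t ht => ?_) (by simp [hinit _ hsη])
  obtain ⟨hlt, hd⟩ := hsol h hhη _ (hrange t ht)
  have hsym := hRsym t (-(sol (π + (-1 : ℝ) ^ (n - 1) * t) h)) (by rwa [abs_neg])
  rw [neg_neg] at hsym
  have haff : HasDerivAt (fun s : ℝ => π + (-1 : ℝ) ^ (n - 1) * s) ((-1 : ℝ) ^ (n - 1)) t := by
    simpa using ((hasDerivAt_id t).const_mul ((-1 : ℝ) ^ (n - 1))).const_add π
  refine (hd.comp t haff).neg.congr_deriv ?_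
  rw [hsym, ← mul_neg, ← hpow, mul_right_comm, hsq, one_mul]
end

section
/- Define d(x₀) = r(−2π, x₀) − x₀ for x₀ > 0 small and d(x₀) = r((−1)ⁿ·2π, x₀) − x₀ for x₀ < 0 small (the displacement of the Poincaré return map from Lemma 2.3). Then there exists a function K(x₀), real-analytic in x₀ for |x₀| small, with K(0) = ∂r/∂h(π, 0) > 0, such that for all x₀ > 0 small, setting x̃₀ = −r(π, x₀) (which is negative), one has d(x̃₀) = −K(x₀)·d(x₀). -/
open Real Set

open Filter Topology

/-- Divided differences of an analytic function along an analytic displacement of the identity: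
the increment `f (g x) - f x` is an analytic multiple of `g x - x`. -/
theorem AnalyticAt.exists_analyticAt_mul_sub {f g : ℝ → ℝ} (hf : AnalyticAt ℝ f 0)
    (hg : AnalyticAt ℝ g 0) (hg0 : g 0 = 0) :
    ∃ K : ℝ → ℝ, AnalyticAt ℝ K 0 ∧ K 0 = deriv f 0 ∧
      ∀ᶠ x in 𝓝[≠] 0, f (g x) - f x = K x * (g x - x) := by
  have hfg : AnalyticAt ℝ (fun x => f (g x)) 0 := AnalyticAt.fun_comp (by rwa [hg0]) hg
  have hnum : AnalyticAt ℝ (fun x => f (g x) - f x) 0 := hfg.sub hf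
  have hden : AnalyticAt ℝ (fun x => g x - x) 0 := hg.sub analyticAt_id
  rcases hden.eventually_eq_zero_or_eventually_ne_zero with h | h
  · refine ⟨fun _ => deriv f 0, analyticAt_const, rfl, ?_⟩
    filter_upwards [h.filter_mono nhdsWithin_le_nhds] with x hx
    rw [hx, sub_eq_zero.1 hx]
    simp
  · set q : ℝ → ℝ := fun x => (f (g x) - f x) / (g x - x) with hq
    have hmer : MeromorphicAt q 0 := hnum.meromorphicAt.div hden.meromorphicAt
    have hK : Function.update q 0 (deriv f 0) =ᶠ[𝓝[≠] 0] q := by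
      filter_upwards [self_mem_nhdsWithin] with x hx
      exact Function.update_of_ne hx _ _
    have hlim : Tendsto q (𝓝[≠] 0) (𝓝 (deriv f 0)) := by
      have hs := hf.hasStrictDerivAt.isLittleO
      have ht : Tendsto (fun x : ℝ => (g x, x)) (𝓝[≠] 0) (𝓝 ((0 : ℝ), (0 : ℝ))) := by
        have : ContinuousAt (fun x : ℝ => (g x, x)) 0 := hg.continuousAt.prodMk continuousAt_id
        simpa [ContinuousAt, hg0] using this.tendsto.mono_left nhdsWithin_le_nhds
      have h0 := (hs.comp_tendsto ht).tendsto_div_nhds_zero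
      have h1 := h0.add_const (deriv f 0)
      rw [zero_add] at h1
      refine h1.congr' ?_
      filter_upwards [h] with x hx
      simp only [Function.comp_apply, hq, ContinuousLinearMap.toSpanSingleton_apply, smul_eq_mul]
      field_simp
      ring
    refine ⟨Function.update q 0 (deriv f 0), ?_, by simp, ?_⟩
    · refine (hmer.congr hK.symm).analyticAt ?_
      rwa [continuousAt_update_same]
    · filter_upwards [h, hK] with x hx hx'
      rw [hx', hq]
      field_simp

theorem AnalyticAt.exists_analyticAt_postcomp {I V W : Type*} [TopologicalSpace I] [CompactSpace I]
    [NormedAddCommGroup V] [NormedSpace ℝ V] [NormedAddCommGroup W] [NormedSpace ℝ W]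
    [CompleteSpace W] {f : V → W} {x₀ : V} (hf : AnalyticAt ℝ f x₀) :
    ∃ N : C(I, V) → C(I, W), AnalyticAt ℝ N (ContinuousMap.const I x₀) ∧
      ∀ᶠ γ in 𝓝 (ContinuousMap.const I x₀), ∀ s, N γ s = f (γ s) := by
  obtain ⟨p, r, hp⟩ := hf
  let P : FormalMultilinearSeries ℝ C(I, V) C(I, W) := fun n =>
    MultilinearMap.mkContinuous
      { toFun := fun w => ⟨fun s => p n fun i => w i s, by fun_prop⟩
        map_update_add' := by
          intro _ w i a b
          ext s
          have h (v : C(I, V)) : (fun j => (Function.update w i v) j s)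
              = Function.update (fun j => w j s) i (v s) := by
            ext j; by_cases hj : j = i
            · subst hj; simp
            · simp [hj]
          simp [h]
        map_update_smul' := by
          intro _ w i c a
          ext s
          have h (v : C(I, V)) : (fun j => (Function.update w i v) j s)
              = Function.update (fun j => w j s) i (v s) := by
            ext j; by_cases hj : j = i
            · subst hj; simp
            · simp [hj]
          simp [h] } ‖p n‖ (by
        intro w
        refine (ContinuousMap.norm_le _ (by positivity)).2 fun s => ?_
        refine ((p n).le_opNorm _).trans ?_
        gcongr with i
        exact (w i).norm_coe_le_norm s)
  have hP (n : ℕ) (w : Fin n → C(I, V)) (s : I) : P n w s = p n fun i => w i s := rfl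
  have hPn (n : ℕ) : ‖P n‖ ≤ ‖p n‖ := MultilinearMap.mkContinuous_norm_le _ (norm_nonneg _) _
  have hrad : 0 < P.radius := by
    obtain ⟨ρ, hρ0, hρ⟩ := ENNReal.lt_iff_exists_nnreal_btwn.1 (hp.r_pos.trans_le hp.r_le)
    obtain ⟨C, -, hC⟩ := p.norm_mul_pow_le_of_lt_radius hρ
    exact hρ0.trans_le <| P.le_radius_of_bound C fun n =>
      (mul_le_mul_of_nonneg_right (hPn n) (by positivity)).trans (hC n)
  have hball := P.hasFPowerSeriesOnBall hrad
  refine ⟨fun γ => P.sum (γ - ContinuousMap.const I x₀), ?_, ?_⟩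
  · refine AnalyticAt.fun_comp (g := P.sum) ?_ (analyticAt_id.sub analyticAt_const)
    simpa using hball.analyticAt
  · have hmin : 0 < min r P.radius := lt_min hp.r_pos hrad
    filter_upwards [Metric.eball_mem_nhds (ContinuousMap.const I x₀) hmin] with γ hγ s
    have hγ' : γ - ContinuousMap.const I x₀ ∈ Metric.eball (0 : C(I, V)) (min r P.radius) := by
      simpa [edist_eq_enorm_sub] using hγ
    have h1 := hball.hasSum (Metric.eball_subset_eball (min_le_right _ _) hγ')
    rw [zero_add] at h1
    have h2 := (ContinuousMap.evalCLM ℝ s).hasSum h1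
    have h3 : γ s - x₀ ∈ Metric.eball (0 : V) r := by
      have : edist (γ s) x₀ ≤ edist γ (ContinuousMap.const I x₀) := by
        rw [edist_dist, edist_dist]
        exact ENNReal.ofReal_le_ofReal (ContinuousMap.dist_apply_le_dist (g := ContinuousMap.const I x₀) s)
      have := (this.trans_lt hγ).trans_le (min_le_left _ _)
      simpa [edist_eq_enorm_sub] using this
    have h4 := hp.hasSum h3
    rw [add_sub_cancel] at h4
    exact h2.unique h4

/-- Integration from `0`, as a continuous linear operator on continuous curves `[0, 1] → V`. -/
theorem ContinuousMap.exists_integral_clm (V : Type*) [NormedAddCommGroup V] [NormedSpace ℝ V]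
    [CompleteSpace V] :
    ∃ J : C(unitInterval, V) →L[ℝ] C(unitInterval, V), ∀ γ s,
      J γ s = ∫ τ in (0 : ℝ)..s, γ (projIcc 0 1 zero_le_one τ) := by
  have hcont (γ : C(unitInterval, V)) : Continuous fun τ : ℝ => γ (projIcc 0 1 zero_le_one τ) :=
    γ.continuous.comp continuous_projIcc
  have hint (γ : C(unitInterval, V)) (a b : ℝ) :
      IntervalIntegrable (fun τ : ℝ => γ (projIcc 0 1 zero_le_one τ)) MeasureTheory.volume a b :=
    (hcont γ).intervalIntegrable a b
  refine ⟨LinearMap.mkContinuous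
    { toFun := fun γ => ⟨fun s => ∫ τ in (0 : ℝ)..s, γ (projIcc 0 1 zero_le_one τ),
        (intervalIntegral.continuous_primitive (hint γ) 0).comp continuous_subtype_val⟩
      map_add' := fun γ₁ γ₂ => by
        ext s
        simp [intervalIntegral.integral_add (hint γ₁ _ _) (hint γ₂ _ _)]
      map_smul' := fun c γ => by
        ext s
        simp } 1 fun γ => ?_, fun γ s => rfl⟩
  refine (ContinuousMap.norm_le _ (by positivity)).2 fun s => ?_
  refine (intervalIntegral.norm_integral_le_of_norm_le_const
    fun τ _ => γ.norm_coe_le_norm _).trans ?_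
  rw [one_mul, sub_zero, abs_of_nonneg s.2.1]
  exact mul_le_of_le_one_right (norm_nonneg _) s.2.2

/-- The endpoints of short integral curves of an analytic vector field depend analytically on the
duration and on the starting point. -/
theorem AnalyticAt.exists_analyticAt_flow {V : Type*} [NormedAddCommGroup V] [NormedSpace ℝ V]
    [CompleteSpace V] {X : V → V} {x₀ : V} (hX : AnalyticAt ℝ X x₀) :
    ∃ Γ : ℝ × V → V, AnalyticAt ℝ Γ (0, x₀) ∧ ∃ U ∈ 𝓝 x₀, ∀ᶠ q in 𝓝 ((0 : ℝ), x₀),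
      ∀ γ : ℝ → V, γ 0 = q.2 →
        (∀ s ∈ Icc (0 : ℝ) 1, γ s ∈ U ∧ HasDerivAt γ (q.1 • X (γ s)) s) → γ 1 = Γ q := by
  obtain ⟨N, hN, hNX⟩ := hX.exists_analyticAt_postcomp (I := unitInterval)
  obtain ⟨J, hJ⟩ := ContinuousMap.exists_integral_clm V
  set c : C(unitInterval, V) := ContinuousMap.const unitInterval x₀ with hc
  let cst : V →L[ℝ] C(unitInterval, V) := ContinuousLinearMap.const ℝ unitInterval
  have hcst (v : V) (s) : cst v s = v := rfl
  let G : ℝ × V × C(unitInterval, V) → ℝ × V × C(unitInterval, V) :=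
    fun p => (p.1, p.2.1, p.2.2 - cst p.2.1 - p.1 • J (N p.2.2))
  let a : ℝ × V × C(unitInterval, V) := (0, x₀, c)
  have hNa : AnalyticAt ℝ (fun p : ℝ × V × C(unitInterval, V) => N p.2.2) a :=
    AnalyticAt.fun_comp (g := N) hN (analyticAt_snd.comp analyticAt_snd)
  have hJN : AnalyticAt ℝ (fun p : ℝ × V × C(unitInterval, V) => J (N p.2.2)) a :=
    (J.analyticAt _).fun_comp hNa
  have hG : AnalyticAt ℝ G a := by
    have h1 : AnalyticAt ℝ (fun p : ℝ × V × C(unitInterval, V) => p.1) a := analyticAt_fst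
    have h2 : AnalyticAt ℝ (fun p : ℝ × V × C(unitInterval, V) => p.2.1) a :=
      analyticAt_fst.fun_comp analyticAt_snd
    have h3 : AnalyticAt ℝ (fun p : ℝ × V × C(unitInterval, V) => p.2.2) a :=
      analyticAt_snd.fun_comp analyticAt_snd
    exact h1.prod (h2.prod ((h3.sub ((cst.analyticAt _).fun_comp h2)).sub (h1.smul hJN)))
  let w : C(unitInterval, V) := J (N c)
  let e : (ℝ × V × C(unitInterval, V)) ≃L[ℝ] (ℝ × V × C(unitInterval, V)) :=
    ContinuousLinearEquiv.equivOfInverse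
      ((ContinuousLinearMap.fst ℝ _ _).prod
        (((ContinuousLinearMap.fst ℝ _ _).comp (ContinuousLinearMap.snd ℝ _ _)).prod
          ((ContinuousLinearMap.snd ℝ _ _).comp (ContinuousLinearMap.snd ℝ _ _)
            - cst.comp ((ContinuousLinearMap.fst ℝ _ _).comp (ContinuousLinearMap.snd ℝ _ _))
            - (ContinuousLinearMap.fst ℝ _ _).smulRight w)))
      ((ContinuousLinearMap.fst ℝ _ _).prod
        (((ContinuousLinearMap.fst ℝ _ _).comp (ContinuousLinearMap.snd ℝ _ _)).prod
          ((ContinuousLinearMap.snd ℝ _ _).comp (ContinuousLinearMap.snd ℝ _ _)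
            + cst.comp ((ContinuousLinearMap.fst ℝ _ _).comp (ContinuousLinearMap.snd ℝ _ _))
            + (ContinuousLinearMap.fst ℝ _ _).smulRight w)))
      (fun p => by
        refine Prod.ext rfl (Prod.ext rfl ?_)
        simp only [ContinuousLinearMap.prod_apply, _root_.sub_apply,
          _root_.add_apply, ContinuousLinearMap.comp_apply,
          ContinuousLinearMap.coe_fst', ContinuousLinearMap.coe_snd',
          ContinuousLinearMap.smulRight_apply]
        abel)
      (fun p => by
        refine Prod.ext rfl (Prod.ext rfl ?_)
        simp only [ContinuousLinearMap.prod_apply, _root_.sub_apply,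
          _root_.add_apply, ContinuousLinearMap.comp_apply,
          ContinuousLinearMap.coe_fst', ContinuousLinearMap.coe_snd',
          ContinuousLinearMap.smulRight_apply]
        abel)
  have hfd : HasFDerivAt G (e : _ →L[ℝ] _) a := by
    have h1 := hasFDerivAt_fst (𝕜 := ℝ) (p := a)
    have h2 := (hasFDerivAt_fst (𝕜 := ℝ) (p := a.2)).comp a (hasFDerivAt_snd (𝕜 := ℝ) (p := a))
    have h3 := (hasFDerivAt_snd (𝕜 := ℝ) (p := a.2)).comp a (hasFDerivAt_snd (𝕜 := ℝ) (p := a))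
    have h4 := hJN.differentiableAt.hasFDerivAt
    have h5 := h1.prodMk (h2.prodMk ((h3.sub (cst.hasFDerivAt.comp a h2)).sub (h1.smul h4)))
    refine h5.congr_fderiv ?_
    ext p <;> simp [a, e, w]
  have hst : HasStrictFDerivAt G (e : _ →L[ℝ] _) a := by
    have := hG.hasStrictFDerivAt
    rwa [hfd.fderiv] at this
  let H := hst.toOpenPartialHomeomorph G
  have haH : a ∈ H.source := hst.mem_toOpenPartialHomeomorph_source
  have hGa : G a = (0, x₀, 0) := by
    ext <;> simp [G, a, hc, hcst]
  have hsymm : AnalyticAt ℝ H.symm (0, x₀, 0) := by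
    rw [← hGa]
    exact H.analyticAt_symm' haH hG hfd.fderiv
  refine ⟨fun q => (H.symm (q.1, q.2, 0)).2.2 1, ?_, ?_⟩
  · have h1 : AnalyticAt ℝ (fun q : ℝ × V => H.symm (q.1, q.2, 0)) (0, x₀) :=
      AnalyticAt.fun_comp (g := H.symm) (f := fun q : ℝ × V => (q.1, q.2, (0 : C(unitInterval, V))))
        hsymm (analyticAt_fst.prod (analyticAt_snd.prod analyticAt_const))
    exact ((ContinuousMap.evalCLM ℝ (1 : unitInterval)).analyticAt _).fun_comp
      (analyticAt_snd.fun_comp (analyticAt_snd.fun_comp h1))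
  · have hsrc : ∀ᶠ p in 𝓝 a, p ∈ H.source ∧ ∀ s, N p.2.2 s = X (p.2.2 s) := by
      refine (H.open_source.eventually_mem haH).and ?_
      have : Tendsto (fun p : ℝ × V × C(unitInterval, V) => p.2.2) (𝓝 a) (𝓝 c) :=
        (continuous_snd.comp continuous_snd).tendsto a
      exact this.eventually hNX
    have hsrc' : ∀ᶠ p in (𝓝 ((0 : ℝ), x₀)) ×ˢ 𝓝 c,
        (p.1.1, p.1.2, p.2) ∈ H.source ∧ ∀ s, N p.2 s = X (p.2 s) := by
      rw [← nhds_prod_eq]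
      have : Tendsto (fun p : (ℝ × V) × C(unitInterval, V) => (p.1.1, p.1.2, p.2))
          (𝓝 ((0, x₀), c)) (𝓝 a) :=
        Continuous.tendsto (by fun_prop) _
      exact this.eventually hsrc
    obtain ⟨A, hA, B, hB, hAB⟩ := eventually_prod_iff.1 hsrc'
    obtain ⟨δ, hδ, hδB⟩ := Metric.eventually_nhds_iff.1 hB
    refine ⟨Metric.ball x₀ (δ / 2), Metric.ball_mem_nhds _ (by positivity), ?_⟩
    filter_upwards [hA] with q hq γ hγ0 hγ
    let g : C(unitInterval, V) := ⟨fun s => γ s,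
      (HasDerivAt.continuousOn fun s hs => (hγ s hs).2).domRestrict⟩
    have hgγ (s : unitInterval) : g s = γ s := rfl
    have hgB : B g := by
      refine hδB (lt_of_le_of_lt ?_ (half_lt_self hδ))
      exact (ContinuousMap.dist_le (by positivity)).2 fun s => (hγ s s.2).1.le
    obtain ⟨hgs, hgN⟩ := hAB hq hgB
    have hGg : G (q.1, q.2, g) = (q.1, q.2, 0) := by
      refine Prod.ext rfl (Prod.ext rfl ?_)
      ext s
      have hcontX : Continuous fun τ : ℝ => q.1 • N g (projIcc 0 1 zero_le_one τ) :=
        ((N g).continuous.comp continuous_projIcc).const_smul q.1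
      have hFTC : ∫ τ in (0 : ℝ)..s, q.1 • N g (projIcc 0 1 zero_le_one τ) = γ s - γ 0 := by
        refine intervalIntegral.integral_eq_sub_of_hasDerivAt (fun τ hτ => ?_)
          (hcontX.intervalIntegrable _ _)
        rw [uIcc_of_le s.2.1] at hτ
        have hτ1 : τ ∈ Icc (0 : ℝ) 1 := ⟨hτ.1, hτ.2.trans s.2.2⟩
        rw [hgN, projIcc_of_mem zero_le_one hτ1]
        exact (hγ τ hτ1).2
      rw [intervalIntegral.integral_smul, ← hJ, hγ0] at hFTC
      simp [G, hcst, hFTC, hgγ]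
    have hinv : H.symm (q.1, q.2, 0) = (q.1, q.2, g) := by
      rw [← hGg]
      exact H.left_inv hgs
    simp [hinv, hgγ]

/-- Uniqueness of solutions for a scalar equation that is analytic on a strip. -/
theorem eqOn_Icc_of_hasDerivAt_of_analyticAt {R : ℝ → ℝ → ℝ} {ε : ℝ}
    (hR : ∀ θ r : ℝ, |r| < ε → AnalyticAt ℝ (fun p : ℝ × ℝ => R p.1 p.2) (θ, r))
    {a b t₀ : ℝ} (ht₀ : t₀ ∈ Ioo a b) {f g : ℝ → ℝ}
    (hf : ∀ t ∈ Icc a b, |f t| < ε ∧ HasDerivAt f (R t (f t)) t)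
    (hg : ∀ t ∈ Icc a b, |g t| < ε ∧ HasDerivAt g (R t (g t)) t)
    (hfg : f t₀ = g t₀) : EqOn f g (Icc a b) := by
  have hfc : ContinuousOn f (Icc a b) := HasDerivAt.continuousOn fun t ht => (hf t ht).2
  have hgc : ContinuousOn g (Icc a b) := HasDerivAt.continuousOn fun t ht => (hg t ht).2
  have hbound : ∃ ρ < ε, ∀ t ∈ Icc a b, |f t| ≤ ρ ∧ |g t| ≤ ρ := by
    obtain ⟨t, ht, hmax⟩ := isCompact_Icc.exists_isMaxOn
      (nonempty_Icc.2 (ht₀.1.trans ht₀.2).le) (hfc.abs.sup hgc.abs)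
    exact ⟨|f t| ⊔ |g t|, max_lt (hf t ht).1 (hg t ht).1, fun s hs =>
      ⟨(le_max_left _ _).trans (hmax hs), (le_max_right _ _).trans (hmax hs)⟩⟩
  obtain ⟨ρ, hρε, hρ⟩ := hbound
  have hsmooth : ContDiffOn ℝ 1 (fun p : ℝ × ℝ => R p.1 p.2) (Icc a b ×ˢ Icc (-ρ) ρ) :=
    fun p hp => (hR p.1 p.2 ((abs_le.2 hp.2).trans_lt hρε)).contDiffAt.contDiffWithinAt
  obtain ⟨K, hK⟩ := hsmooth.exists_lipschitzOnWith one_ne_zero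
    ((convex_Icc a b).prod (convex_Icc (-ρ) ρ)) (isCompact_Icc.prod isCompact_Icc)
  refine ODE_solution_unique_of_mem_Icc (v := R) (K := K) (s := fun _ => Icc (-ρ) ρ) ?_ ht₀
    hfc (fun t ht => (hf t (Ioo_subset_Icc_self ht)).2)
    (fun t ht => abs_le.1 (hρ t (Ioo_subset_Icc_self ht)).1)
    hgc (fun t ht => (hg t (Ioo_subset_Icc_self ht)).2)
    (fun t ht => abs_le.1 (hρ t (Ioo_subset_Icc_self ht)).2) hfg
  intro t ht x hx y hy
  have := hK (x := (t, x)) ⟨Ioo_subset_Icc_self ht, hx⟩ (y := (t, y)) ⟨Ioo_subset_Icc_self ht, hy⟩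
  simpa [Prod.edist_eq] using this

/-- Solutions near the zero solution of a scalar equation that is analytic along it depend
analytically on the parameter at every time, once they do so at one time. -/
theorem analyticAt_of_hasDerivAt_of_analyticAt {R sol : ℝ → ℝ → ℝ} {a b t₀ η : ℝ} (hη : 0 < η)
    (ht₀ : t₀ ∈ Ioo a b)
    (hR : ∀ t ∈ Ioo a b, AnalyticAt ℝ (fun p : ℝ × ℝ => R p.1 p.2) (t, 0))
    (hsol : ∀ h : ℝ, |h| < η → ∀ t ∈ Ioo a b, HasDerivAt (fun s => sol s h) (R t (sol t h)) t)
    (hcont : ContinuousOn (fun p : ℝ × ℝ => sol p.1 p.2) (Ioo a b ×ˢ Metric.ball (0 : ℝ) η))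
    (hzero : ∀ t ∈ Ioo a b, sol t 0 = 0) (hinit : AnalyticAt ℝ (sol t₀) 0) :
    ∀ t ∈ Ioo a b, AnalyticAt ℝ (sol t) 0 := by
  have hlocal : ∀ c ∈ Ioo a b, ∃ δ > 0, ∀ t₁ ∈ Ioo (c - δ) (c + δ), ∀ t₂ ∈ Ioo (c - δ) (c + δ),
      AnalyticAt ℝ (sol t₁) 0 → AnalyticAt ℝ (sol t₂) 0 := by
    intro c hc
    have hX : AnalyticAt ℝ (fun p : ℝ × ℝ => ((1 : ℝ), R p.1 p.2)) (c, 0) :=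
      analyticAt_const.prod (hR c hc)
    obtain ⟨Γ, hΓ, U, hU, hflow⟩ := hX.exists_analyticAt_flow
    have hcurve : ContinuousAt (fun p : ℝ × ℝ => (p.1, sol p.1 p.2)) (c, 0) :=
      continuousAt_fst.prodMk <| hcont.continuousAt <|
        prod_mem_nhds (Ioo_mem_nhds hc.1 hc.2) (Metric.ball_mem_nhds _ hη)
    have hUev : ∀ᶠ p in 𝓝 (c, (0 : ℝ)), (p.1, sol p.1 p.2) ∈ U := by
      refine hcurve.eventually_mem ?_
      simpa [hzero c hc] using hU
    obtain ⟨δ₁, hδ₁, hUδ⟩ := Metric.eventually_nhds_iff.1 hUev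
    obtain ⟨δ₂, hδ₂, hab⟩ := Metric.eventually_nhds_iff.1 (Ioo_mem_nhds hc.1 hc.2)
    obtain ⟨δ₃, hδ₃, hflow⟩ := Metric.eventually_nhds_iff.1
      (hflow.and hΓ.eventually_analyticAt)
    refine ⟨min (min δ₁ δ₂) (δ₃ / 2), by positivity, fun t₁ ht₁ t₂ ht₂ han => ?_⟩
    set δ := min (min δ₁ δ₂) (δ₃ / 2) with hδ
    have hδ₁' : δ ≤ δ₁ := (min_le_left _ _).trans (min_le_left _ _)
    have hδ₂' : δ ≤ δ₂ := (min_le_left _ _).trans (min_le_right _ _)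
    have hδ₃' : δ ≤ δ₃ / 2 := min_le_right _ _
    have hdist {t : ℝ} (ht : t ∈ Ioo (c - δ) (c + δ)) : dist t c < δ := by
      rwa [← Real.ball_eq_Ioo] at ht
    have hmem {t : ℝ} (ht : t ∈ Ioo (c - δ) (c + δ)) : t ∈ Ioo a b :=
      hab ((hdist ht).trans_le hδ₂')
    have h12 : |t₂ - t₁| < δ₃ := by
      rw [abs_lt]; constructor <;> linarith [ht₁.1, ht₁.2, ht₂.1, ht₂.2]
    have hΓ₁ : AnalyticAt ℝ Γ (t₂ - t₁, (t₁, 0)) := by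
      refine (hflow ?_).2
      simp only [Prod.dist_eq, dist_self, sup_lt_iff]
      refine ⟨by simpa [Real.dist_eq] using h12, (hdist ht₁).trans_le (by linarith), hδ₃⟩
    have hstart : AnalyticAt ℝ (fun h => (t₂ - t₁, (t₁, sol t₁ h))) 0 :=
      analyticAt_const.prod (analyticAt_const.prod han)
    have hcomp : AnalyticAt ℝ (fun h => (Γ (t₂ - t₁, (t₁, sol t₁ h))).2) 0 :=
      analyticAt_snd.fun_comp <| AnalyticAt.fun_comp (g := Γ)
        (f := fun h => (t₂ - t₁, (t₁, sol t₁ h))) (by simpa [hzero t₁ (hmem ht₁)] using hΓ₁) hstart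
    refine hcomp.congr ?_
    have hsmall : ∀ᶠ h in 𝓝 (0 : ℝ), |sol t₁ h| < δ₃ := by
      have : ContinuousAt (fun h => |sol t₁ h|) 0 := han.continuousAt.abs
      refine this.eventually_lt continuousAt_const ?_
      simpa [hzero t₁ (hmem ht₁)] using hδ₃
    filter_upwards [hsmall, Metric.ball_mem_nhds (0 : ℝ) hη, Metric.ball_mem_nhds (0 : ℝ) hδ₁]
      with h hh hhη hhδ
    rw [mem_ball_zero_iff, Real.norm_eq_abs] at hhη
    have hq : dist (t₂ - t₁, (t₁, sol t₁ h)) ((0 : ℝ), (c, (0 : ℝ))) < δ₃ := by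
      simp only [Prod.dist_eq, sup_lt_iff]
      refine ⟨by simpa [Real.dist_eq] using h12, (hdist ht₁).trans_le (by linarith), ?_⟩
      simpa [Real.dist_eq] using hh
    have key := (hflow hq).1 (fun s => (t₁ + s * (t₂ - t₁), sol (t₁ + s * (t₂ - t₁)) h))
      (by simp) ?_
    · rw [← key]
      simp
    · intro s hs
      have hts : t₁ + s * (t₂ - t₁) ∈ Ioo (c - δ) (c + δ) := by
        have := (convex_Ioo (c - δ) (c + δ)).add_smul_sub_mem ht₁ ht₂ hs
        simpa using this
      refine ⟨hUδ (y := (t₁ + s * (t₂ - t₁), h)) ?_, ?_⟩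
      · rw [Prod.dist_eq, sup_lt_iff]
        exact ⟨(hdist hts).trans_le hδ₁', hhδ⟩
      · have hlin : HasDerivAt (fun s => t₁ + s * (t₂ - t₁)) (t₂ - t₁) s := by
          simpa using ((hasDerivAt_id s).mul_const (t₂ - t₁)).const_add t₁
        have h2 := (hsol h hhη _ (hmem hts)).comp s hlin
        refine (hlin.prodMk h2).congr_deriv ?_
        simp [mul_comm]
  have hP : ∀ s t : Ioo a b, AnalyticAt ℝ (sol s) 0 ↔ AnalyticAt ℝ (sol t) 0 := by
    have : PreconnectedSpace (Ioo a b) := Subtype.preconnectedSpace isPreconnected_Ioo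
    refine fun s t => PreconnectedSpace.induction₂'
      (fun s t : Ioo a b => AnalyticAt ℝ (sol s) 0 ↔ AnalyticAt ℝ (sol t) 0) (fun x => ?_)
      ⟨fun _ _ _ h h' => h.trans h'⟩ s t
    obtain ⟨δ, hδ, hx⟩ := hlocal x x.2
    have hmem : Ioo ((x : ℝ) - δ) (x + δ) ∈ 𝓝 (x : ℝ) := Ioo_mem_nhds (by linarith) (by linarith)
    filter_upwards [continuous_subtype_val.continuousAt.preimage_mem_nhds hmem] with y hy
    have hiff : AnalyticAt ℝ (sol x) 0 ↔ AnalyticAt ℝ (sol y) 0 :=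
      ⟨hx x (mem_of_mem_nhds hmem) y hy, hx y hy x (mem_of_mem_nhds hmem)⟩
    exact ⟨hiff, hiff.symm⟩
  exact fun t ht => (hP ⟨t₀, ht₀⟩ ⟨t, ht⟩).1 hinit

/-- **Lemma 2.4.**  With `r(θ,h)` the solution of `dr/dθ = R̄(θ,r)`, `r(0,h) = h`
(with `R̄` analytic, `2π`-periodic in `θ`, vanishing at `r = 0`, and satisfying the
symmetry (2.6)), define the displacement `d(x₀) = r(-2π,x₀) - x₀` for `x₀ > 0` and
`d(x₀) = r((-1)ⁿ2π, x₀) - x₀` for `x₀ ≤ 0`.  Then there is a real-analytic factor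
`K(x₀)` with `K(0) = ∂r/∂h(π,0) > 0` such that, for `x₀ > 0` small,
`x̃₀ = -r(π,x₀)` is negative and `d(x̃₀) = -K(x₀)·d(x₀)`. -/
theorem displacement_reflection
    (n : ℕ) (hn : 2 ≤ n) (ε : ℝ) (hε : 0 < ε)
    (Rb : ℝ → ℝ → ℝ)
    (hRana : ∀ θ r : ℝ, |r| < ε → AnalyticAt ℝ (fun p : ℝ × ℝ => Rb p.1 p.2) (θ, r))
    (hRper : ∀ θ r : ℝ, Rb (θ + 2 * π) r = Rb θ r)
    (hR0 : ∀ θ : ℝ, Rb θ 0 = 0)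
    (hRsym : ∀ θ r : ℝ, |r| < ε →
      Rb (π + (-1 : ℝ) ^ (n - 1) * θ) (-r) = (-1 : ℝ) ^ n * Rb θ r)
    (sol : ℝ → ℝ → ℝ) (η : ℝ) (hη : 0 < η) (hηε : η ≤ ε)
    (hinit : ∀ h : ℝ, |h| < η → sol 0 h = h)
    (hsol : ∀ h : ℝ, |h| < η → ∀ θ ∈ Icc (-(4 * π)) (4 * π),
      |sol θ h| < ε ∧ HasDerivAt (fun s => sol s h) (Rb θ (sol θ h)) θ)
    (hcont : ContinuousOn (fun p : ℝ × ℝ => sol p.1 p.2)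
      (Icc (-(4 * π)) (4 * π) ×ˢ Metric.ball (0 : ℝ) η))
    (d : ℝ → ℝ)
    (hd : ∀ x₀ : ℝ, |x₀| < η →
      d x₀ = (if 0 < x₀ then sol (-(2 * π)) x₀ else sol ((-1 : ℝ) ^ n * (2 * π)) x₀) - x₀) :
    ∃ K : ℝ → ℝ, ∃ η' > 0,
      (∀ x : ℝ, |x| < η' → AnalyticAt ℝ K x) ∧
      K 0 = deriv (fun h => sol π h) 0 ∧ 0 < K 0 ∧
      ∀ x₀ : ℝ, 0 < x₀ → x₀ < η' →
        0 < sol π x₀ ∧ d (-(sol π x₀)) = -(K x₀) * d x₀ := by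
  have hπ := Real.pi_pos
  set σ : ℝ := (-1 : ℝ) ^ n with hσ
  have hσσ : σ * σ = 1 := by
    rw [hσ, ← mul_pow]
    norm_num
  have hσ1 : σ = 1 ∨ σ = -1 := neg_one_pow_eq_or ℝ n
  have hσ' : (-1 : ℝ) ^ (n - 1) = -σ := by
    obtain ⟨m, rfl⟩ : ∃ m, n = m + 1 := ⟨n - 1, by omega⟩
    simp [hσ, pow_succ]
  have hzero_sol : ∀ t : ℝ, |(0 : ℝ)| < ε ∧ HasDerivAt (fun _ : ℝ => (0 : ℝ)) (Rb t 0) t :=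
    fun t => ⟨by simpa using hε, by simpa [hR0] using hasDerivAt_const t (0 : ℝ)⟩
  have hη0 : |(0 : ℝ)| < η := by simpa using hη
  have hzero : ∀ θ ∈ Icc (-(4 * π)) (4 * π), sol θ 0 = 0 :=
    eqOn_Icc_of_hasDerivAt_of_analyticAt hRana (t₀ := 0) ⟨by linarith, by linarith⟩
      (hsol 0 hη0) (fun t _ => hzero_sol t) (hinit 0 hη0)
  have han : ∀ θ ∈ Ioo (-(4 * π)) (4 * π), AnalyticAt ℝ (sol θ) 0 := by
    refine analyticAt_of_hasDerivAt_of_analyticAt hη (t₀ := 0) ⟨by linarith, by linarith⟩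
      (fun t _ => hRana t 0 (by simpa using hε))
      (fun h hh t ht => (hsol h hh t (Ioo_subset_Icc_self ht)).2)
      (hcont.mono (prod_mono Ioo_subset_Icc_self subset_rfl))
      (fun t ht => hzero t (Ioo_subset_Icc_self ht)) ?_
    refine analyticAt_id.congr ?_
    filter_upwards [Metric.ball_mem_nhds (0 : ℝ) hη] with h hh
    rw [mem_ball_zero_iff, Real.norm_eq_abs] at hh
    exact (hinit h hh).symm
  have hreflect : ∀ h, |h| < η → |sol π h| < η → ∀ θ ∈ Icc (-(5 / 2 * π)) (5 / 2 * π),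
      sol θ (-(sol π h)) = -(sol (π - σ * θ) h) := by
    intro h hh hf
    have hf' : |-(sol π h)| < η := by rwa [abs_neg]
    refine eqOn_Icc_of_hasDerivAt_of_analyticAt hRana (t₀ := 0) ⟨by linarith, by linarith⟩
      (fun t ht => hsol _ hf' t ⟨by linarith [ht.1], by linarith [ht.2]⟩) (fun t ht => ?_)
      (by simp [hinit _ hf'])
    have ht' : π - σ * t ∈ Icc (-(4 * π)) (4 * π) := by
      rcases hσ1 with h1 | h1 <;> rw [h1] <;> constructor <;> linarith [ht.1, ht.2]
    obtain ⟨hlt, hder⟩ := hsol h hh _ ht'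
    refine ⟨by rwa [abs_neg], ?_⟩
    have hlin : HasDerivAt (fun s => π - σ * s) (-σ) t := by
      simpa using ((hasDerivAt_id t).const_mul σ).const_sub π
    refine (hder.comp t hlin).neg.congr_deriv ?_
    have hs := hRsym t (-(sol (π - σ * t) h)) (by rwa [abs_neg])
    rw [hσ', neg_neg, neg_mul, ← sub_eq_add_neg] at hs
    rw [hs]
    linear_combination Rb t (-(sol (π - σ * t) h)) * hσσ
  have hperiod : ∀ h, |h| < η → |sol (-(2 * π)) h| < η →
      ∀ θ ∈ Icc (-(3 / 2 * π)) (5 / 2 * π), sol θ (sol (-(2 * π)) h) = sol (θ - 2 * π) h := by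
    intro h hh hg
    refine eqOn_Icc_of_hasDerivAt_of_analyticAt hRana (t₀ := 0) ⟨by linarith, by linarith⟩
      (fun t ht => hsol _ hg t ⟨by linarith [ht.1], by linarith [ht.2]⟩) (fun t ht => ?_)
      (by simp [hinit _ hg])
    obtain ⟨hlt, hder⟩ := hsol h hh (t - 2 * π) ⟨by linarith [ht.1], by linarith [ht.2]⟩
    refine ⟨hlt, ?_⟩
    have := hder.comp_sub_const t (2 * π)
    rwa [← hRper (t - 2 * π), sub_add_cancel] at this
  have hpos : ∀ h, 0 < h → h < η → 0 < sol π h := by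
    intro h h0 hh
    have hh' : |h| < η := by rwa [abs_of_pos h0]
    by_contra! hle
    have hc : ContinuousOn (fun s => sol s h) (Icc 0 π) := HasDerivAt.continuousOn fun s hs =>
      (hsol h hh' s ⟨by linarith [hs.1], by linarith [hs.2]⟩).2
    obtain ⟨t, ht, ht0⟩ := intermediate_value_Icc' hπ.le hc
      (show (0 : ℝ) ∈ Icc (sol π h) (sol 0 h) from ⟨hle, by rw [hinit h hh']; exact h0.le⟩)
    have hEq := eqOn_Icc_of_hasDerivAt_of_analyticAt hRana (t₀ := t) (a := -(4 * π)) (b := 4 * π)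
      ⟨by linarith [ht.1], by linarith [ht.2]⟩ (hsol h hh') (fun t _ => hzero_sol t) ht0
    have h00 := hEq (x := 0) ⟨by linarith, by linarith⟩
    simp only [hinit h hh'] at h00
    exact h0.ne' h00
  have hπmem : π ∈ Ioo (-(4 * π)) (4 * π) := ⟨by linarith, by linarith⟩
  have h2πmem : -(2 * π) ∈ Ioo (-(4 * π)) (4 * π) := ⟨by linarith, by linarith⟩
  have hfan := han π hπmem
  have hgan := han _ h2πmem
  have hf0 := hzero _ (Ioo_subset_Icc_self hπmem)
  have hg0 := hzero _ (Ioo_subset_Icc_self h2πmem)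
  have hsmall {θ : ℝ} (hθ : AnalyticAt ℝ (sol θ) 0) (hθ0 : sol θ 0 = 0) :
      ∀ᶠ x in 𝓝 (0 : ℝ), |sol θ x| < η := by
    refine hθ.continuousAt.abs.eventually_lt continuousAt_const ?_
    simpa [hθ0] using hη
  have hid : ∀ᶠ x in 𝓝 (0 : ℝ), |x| < η :=
    continuousAt_id.abs.eventually_lt continuousAt_const hη0
  have hderiv_nonneg : 0 ≤ deriv (sol π) 0 := by
    have hslope := hfan.differentiableAt.hasDerivAt.tendsto_slope_zero_right
    refine ge_of_tendsto hslope ?_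
    filter_upwards [self_mem_nhdsWithin, hid.filter_mono nhdsWithin_le_nhds] with x hx hxη
    have hx0 : 0 < x := hx
    have := hpos x hx0 (lt_of_abs_lt hxη)
    simp only [zero_add, hf0, sub_zero, smul_eq_mul]
    positivity
  have hderiv_ne : deriv (sol π) 0 ≠ 0 := by
    intro hd0
    have hσπ : σ * π ∈ Ioo (-(5 / 2 * π)) (5 / 2 * π) := by
      rcases hσ1 with h1 | h1 <;> rw [h1] <;> constructor <;> linarith
    have hb : AnalyticAt ℝ (sol (σ * π)) 0 :=
      han _ ⟨by linarith [hσπ.1], by linarith [hσπ.2]⟩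
    have hb' : HasDerivAt (sol (σ * π)) (deriv (sol (σ * π)) 0) (-(sol π 0)) := by
      rw [hf0, neg_zero]
      exact hb.differentiableAt.hasDerivAt
    have hcomp := hb'.comp (0 : ℝ) hfan.differentiableAt.hasDerivAt.fun_neg
    have hneg : HasDerivAt (fun h : ℝ => -h) (deriv (sol (σ * π)) 0 * -deriv (sol π) 0) 0 := by
      refine hcomp.congr_of_eventuallyEq ?_
      filter_upwards [hid, hsmall hfan hf0] with h hh hfh
      have := hreflect h hh hfh _ (Ioo_subset_Icc_self hσπ)
      rw [← mul_assoc, hσσ, one_mul, sub_self, hinit h hh] at this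
      exact this.symm
    have := hneg.unique (hasDerivAt_neg (0 : ℝ))
    simp [hd0] at this
  obtain ⟨K, hKan, hK0, hK⟩ := hfan.exists_analyticAt_mul_sub hgan hg0
  have hKpos : 0 < K 0 := hK0 ▸ lt_of_le_of_ne hderiv_nonneg hderiv_ne.symm
  obtain ⟨η', hη', hall⟩ := Metric.eventually_nhds_iff.1
    (hKan.eventually_analyticAt.and <| (eventually_nhdsWithin_iff.1 hK).and <|
      hid.and <| (hsmall hfan hf0).and (hsmall hgan hg0))
  simp only [Real.dist_eq, sub_zero] at hall
  refine ⟨K, η', hη', fun x hx => (hall hx).1, hK0, hKpos, fun x hx hxη' => ?_⟩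
  obtain ⟨-, hKx, hxη, hfx, hgx⟩ := hall (by rwa [abs_of_pos hx])
  have hfpos := hpos x hx (lt_of_abs_lt hxη)
  refine ⟨hfpos, ?_⟩
  rw [hd x hxη, if_pos hx, hd _ (by rwa [abs_neg]), if_neg (by linarith)]
  have h1 := hreflect x hxη hfx (σ * (2 * π)) (by
    rcases hσ1 with h1 | h1 <;> rw [h1] <;> constructor <;> linarith)
  have h2 := hperiod x hxη hgx π ⟨by linarith, by linarith⟩
  have h3 := hKx hx.ne'
  rw [← mul_assoc σ σ, hσσ, one_mul] at h1
  rw [h1, ← h2]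
  linear_combination -h3
end
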